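/- arXiv:0912.4713 — 4 statements merged into one kernel-verified Lean document; each statement's English description precedes it below -/
import Mathlib

section
/- Let (x,σ) be a forward complete trajectory of the switched system ẋ = f(x,σ) with σ ∈ S_a, and suppose (x,σ) is precompact relative to a set O ⊆ ℝⁿ. Then Ω♯(x,σ) ⊆ dom(f) ∩ (O × Γ) and Ω(x) = π₁(Ω♯(x,σ)). -/
open Filter Topology MeasureTheory Set

noncomputable section

abbrev Eucl (n : ℕ) : Type := EuclideanSpace ℝ (Fin n)

/-- The set of discontinuity (switching) times of a signal. -/
def JumpTimes {Γ : Type*} [TopologicalSpace Γ] (σ : ℝ → Γ) : Set ℝ :=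
  {t | ¬ ContinuousAt σ t}

/-- A switching signal: piecewise constant (finitely many discontinuities in every
compact interval, locally constant to the right and on a left punctured neighborhood
of every point) and continuous from the right. -/
structure IsSwitchingSignal {Γ : Type*} [TopologicalSpace Γ] (σ : ℝ → Γ) : Prop where
  locFinite : ∀ a b : ℝ, (JumpTimes σ ∩ Set.Icc a b).Finite
  rightConst : ∀ t : ℝ, ∃ ε > (0:ℝ), ∀ s ∈ Set.Ico t (t + ε), σ s = σ t
  leftConst : ∀ t : ℝ, ∃ ε > (0:ℝ), ∀ s ∈ Set.Ioo (t - ε) t, ∀ s' ∈ Set.Ioo (t - ε) t, σ s = σ s'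

/-- `SA Γ τD N₀` : switching signals with average dwell time `τD` and chatter bound `N₀`. -/
def SA (Γ : Type*) [TopologicalSpace Γ] (τD : ℝ) (N₀ : ℕ) : Set (ℝ → Γ) :=
  {σ | IsSwitchingSignal σ ∧ ∀ τ₁ τ₂ : ℝ, τ₁ < τ₂ →
    ((JumpTimes σ ∩ Set.Ioo τ₁ τ₂).ncard : ℝ) ≤ (N₀ : ℝ) + (τ₂ - τ₁) / τD}

def SAall (Γ : Type*) [TopologicalSpace Γ] : Set (ℝ → Γ) :=
  ⋃ τD ∈ Set.Ioi (0 : ℝ), ⋃ N₀ : ℕ, SA Γ τD N₀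

/-- Dwell-time signals. -/
def SD (Γ : Type*) [TopologicalSpace Γ] (τD : ℝ) : Set (ℝ → Γ) := SA Γ τD 1

def SDall (Γ : Type*) [TopologicalSpace Γ] : Set (ℝ → Γ) :=
  ⋃ τD ∈ Set.Ioi (0 : ℝ), SD Γ τD

/-- First switching time strictly greater than `t` (`⊤` if none). -/
def tau1 {Γ : Type*} [TopologicalSpace Γ] (σ : ℝ → Γ) (t : ℝ) : EReal :=
  sInf (Real.toEReal '' (JumpTimes σ ∩ Set.Ioi t))

/-- The class `S^H` of switching signals compatible with the set-valued map `H`: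
at each switching time the new value belongs to `H` of the left limit. -/
def SH {Γ : Type*} [TopologicalSpace Γ] (H : Γ → Set Γ) : Set (ℝ → Γ) :=
  {σ | ∀ t ∈ JumpTimes σ, ∀ γ' : Γ,
    Filter.Tendsto σ (nhdsWithin t (Set.Iio t)) (nhds γ') → σ t ∈ H γ'}

/-- The "ergodic" class `S_e[T]`. -/
def SE (Γ : Type*) [TopologicalSpace Γ] (T : ℝ) : Set (ℝ → Γ) :=
  {σ | ∀ t₀ : ℝ, 0 ≤ t₀ → ∀ γ : Γ, ∃ t ∈ Set.Icc t₀ (t₀ + T), σ t = γ}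

def SEall (Γ : Type*) [TopologicalSpace Γ] : Set (ℝ → Γ) :=
  ⋃ T ∈ Set.Ioi (0 : ℝ), SE Γ T

/-- Property P of a family of switching signals. -/
def HasPropertyP {Γ : Type*} [TopologicalSpace Γ] (S : Set (ℝ → Γ)) : Prop :=
  (∃ τD > (0 : ℝ), ∃ N₀ : ℕ, S ⊆ SA Γ τD N₀) ∧
  (∀ σ ∈ S, ∀ s > (0 : ℝ), (fun t => σ (t + s)) ∈ S) ∧
  (∀ σseq : ℕ → ℝ → Γ, (∀ k, σseq k ∈ S) →
    ∃ σstar ∈ S, ∃ φ : ℕ → ℕ, StrictMono φ ∧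
      ∀ᵐ t ∂(volume : Measure ℝ),
        Filter.Tendsto (fun l => σseq (φ l) t) Filter.atTop (nhds (σstar t)))

/-- A solution of `ẋ = g(x)` with values in `X`, on the set `I`. -/
def IsSolOn {n : ℕ} (g : Eucl n → Eucl n) (X : Set (Eucl n)) (φ : ℝ → Eucl n) (I : Set ℝ) : Prop :=
  ContinuousOn φ I ∧ (∀ t ∈ I, φ t ∈ X) ∧
  ∀ t₀ ∈ I, ∀ t ∈ I,
    IntervalIntegrable (fun s => g (φ s)) volume t₀ t ∧
    φ t = φ t₀ + ∫ s in t₀..t, g (φ s)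

/-- A trajectory of the switched system `ẋ = f(x,σ)` on the interval `I`. -/
structure IsTrajectory {n : ℕ} {Γ : Type*} [TopologicalSpace Γ]
    (f : Eucl n × Γ → Eucl n) (domf : Set (Eucl n × Γ))
    (x : ℝ → Eucl n) (σ : ℝ → Γ) (I : Set ℝ) : Prop where
  signal : IsSwitchingSignal σ
  nonempty : I.Nonempty
  ordConn : I.OrdConnected
  cont : ContinuousOn x I
  mem : ∀ t ∈ I, (x t, σ t) ∈ domf
  intg : ∀ t₀ ∈ I, ∀ t ∈ I,
    IntervalIntegrable (fun s => f (x s, σ s)) volume t₀ t ∧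
    x t = x t₀ + ∫ s in t₀..t, f (x s, σ s)

/-- Precompactness of a trajectory relative to `O`. -/
def PrecompactRel {n : ℕ} (x : ℝ → Eucl n) (I : Set ℝ) (O : Set (Eucl n)) : Prop :=
  ∃ B : Set (Eucl n), B ⊆ O ∧ IsCompact B ∧ ∀ t ∈ I, x t ∈ B

/-- ω-limit set of `x` defined on `I`. -/
def OmegaLimit {n : ℕ} (x : ℝ → Eucl n) (I : Set ℝ) : Set (Eucl n) :=
  {ξ | ∃ s : ℕ → ℝ, StrictMono s ∧ (∀ k, s k ∈ I) ∧
    Filter.Tendsto s Filter.atTop Filter.atTop ∧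
    Filter.Tendsto (fun k => x (s k)) Filter.atTop (nhds ξ)}

/-- The set `Ω♯(x,σ)`. -/
def OmegaSharp {n : ℕ} {Γ : Type*} [TopologicalSpace Γ] (x : ℝ → Eucl n) (σ : ℝ → Γ) :
    Set (Eucl n × Γ) :=
  {p | ∃ s : ℕ → ℝ, StrictMono s ∧ (∀ k, 0 ≤ s k) ∧
    Filter.Tendsto s Filter.atTop Filter.atTop ∧
    (∃ r : EReal, 0 < r ∧
      Filter.Tendsto (fun k => tau1 σ (s k) - Real.toEReal (s k)) Filter.atTop (nhds r)) ∧
    Filter.Tendsto (fun k => x (s k)) Filter.atTop (nhds p.1) ∧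
    Filter.Tendsto (fun k => σ (s k)) Filter.atTop (nhds p.2)}

/-- Weak invariance of `M` w.r.t. the family of complete trajectories `T`
(without the nonemptiness requirement). -/
def WeaklyInvariantCore {n : ℕ} {Γ : Type*} (T : Set ((ℝ → Eucl n) × (ℝ → Γ)))
    (M : Set (Eucl n × Γ)) : Prop :=
  ∀ p ∈ M, ∃ xs ∈ T, xs.1 0 = p.1 ∧ xs.2 0 = p.2 ∧ ∀ t : ℝ, (xs.1 t, xs.2 t) ∈ M

/-- Weak invariance of a nonempty set `M` w.r.t. `T`. -/
def WeaklyInvariant {n : ℕ} {Γ : Type*} (T : Set ((ℝ → Eucl n) × (ℝ → Γ)))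
    (M : Set (Eucl n × Γ)) : Prop :=
  M.Nonempty ∧ WeaklyInvariantCore T M

/-- Maximal weakly invariant subset of `S` w.r.t. `T`. -/
def MaxWeaklyInvariantIn {n : ℕ} {Γ : Type*} (T : Set ((ℝ → Eucl n) × (ℝ → Γ)))
    (S : Set (Eucl n × Γ)) : Set (Eucl n × Γ) :=
  ⋃₀ {M | M ⊆ S ∧ WeaklyInvariantCore T M}

/-- All complete trajectories whose switching signal lies in `S`. -/
def TrajOf {n : ℕ} {Γ : Type*} [TopologicalSpace Γ] (f : Eucl n × Γ → Eucl n)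
    (domf : Set (Eucl n × Γ)) (S : Set (ℝ → Γ)) : Set ((ℝ → Eucl n) × (ℝ → Γ)) :=
  {xs | IsTrajectory f domf xs.1 xs.2 Set.univ ∧ xs.2 ∈ S}

/-- `x → M` : convergence of `x(t)` to the set `M` as `t → +∞`. -/
def ConvergesTo {n : ℕ} (x : ℝ → Eucl n) (M : Set (Eucl n)) : Prop :=
  Filter.Tendsto (fun t => Metric.infDist (x t) M) Filter.atTop (nhds 0)

def Oset {n : ℕ} {Γ : Type*} (domV : Set (Eucl n × Γ)) : Set (Eucl n) := Prod.fst '' domV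

def Ogamma {n : ℕ} {Γ : Type*} (domV domf : Set (Eucl n × Γ)) (γ : Γ) : Set (Eucl n) :=
  {ξ | ξ ∈ Oset domV ∧ (ξ, γ) ∈ domf}

/-- The class 𝒱 of functions. -/
structure ClassVFun {n : ℕ} {Γ : Type*} (V : Eucl n × Γ → ℝ)
    (domV domf : Set (Eucl n × Γ)) : Prop where
  openD : ∀ γ : Γ, IsOpen {ξ : Eucl n | (ξ, γ) ∈ domV}
  subD : ∀ γ : Γ, ∀ ξ ∈ Ogamma domV domf γ, (ξ, γ) ∈ domV
  diff : ∀ γ : Γ, ∀ ξ ∈ Ogamma domV domf γ, DifferentiableAt ℝ (fun ξ' => V (ξ', γ)) ξ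

/-- The set `Z_V`. -/
def ZV {n : ℕ} {Γ : Type*} (f : Eucl n × Γ → Eucl n) (V : Eucl n × Γ → ℝ)
    (domV domf : Set (Eucl n × Γ)) : Set (Eucl n × Γ) :=
  {p | p ∈ domf ∧ p.1 ∈ Oset domV ∧ fderiv ℝ (fun ξ' => V (ξ', p.2)) p.1 (f p) = 0}

/-- Assumption (A1). -/
structure AssumptionA1 {n : ℕ} {Γ : Type*} [TopologicalSpace Γ]
    (domf : Set (Eucl n × Γ)) (V : Eucl n × Γ → ℝ) (domV : Set (Eucl n × Γ))
    (x : ℝ → Eucl n) (σ : ℝ → Γ) (I : Set ℝ) : Prop where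
  classV : ClassVFun V domV domf
  contV : ContinuousOn V (domf ∩ (Oset domV ×ˢ (Set.univ : Set Γ)))
  precompact : PrecompactRel x I (Oset domV)
  nonincr : AntitoneOn (fun t => V (x t, σ t)) (Set.Ici 0)

/-- Assumption (A2) (for finite Γ). -/
structure AssumptionA2 {n : ℕ} {Γ : Type*} [TopologicalSpace Γ]
    (domf : Set (Eucl n × Γ)) (V : Eucl n × Γ → ℝ) (domV : Set (Eucl n × Γ))
    (x : ℝ → Eucl n) (σ : ℝ → Γ) (I : Set ℝ) : Prop where
  classV : ClassVFun V domV domf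
  precompact : PrecompactRel x I (Oset domV)
  nonincr : ∀ γ : Γ, AntitoneOn (fun t => V (x t, σ t)) ({t | σ t = γ} ∩ Set.Ici 0)

/-- The inequality `−∇V_γ(ξ)·f_γ(ξ) ≥ W_γ(ξ) ≥ 0` on each `O_γ`. -/
def Wineq {n : ℕ} {Γ : Type*} (f : Eucl n × Γ → Eucl n) (V W : Eucl n × Γ → ℝ)
    (domV domf : Set (Eucl n × Γ)) : Prop :=
  ∀ γ : Γ, ∀ ξ ∈ Ogamma domV domf γ,
    W (ξ, γ) ≤ -(fderiv ℝ (fun ξ' => V (ξ', γ)) ξ (f (ξ, γ))) ∧ 0 ≤ W (ξ, γ)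

/-- Assumption (A4). -/
structure AssumptionA4 {n : ℕ} {Γ : Type*} [TopologicalSpace Γ] (f : Eucl n × Γ → Eucl n)
    (domf : Set (Eucl n × Γ)) (V : Eucl n × Γ → ℝ) (domV : Set (Eucl n × Γ))
    (W : Eucl n × Γ → ℝ) (x : ℝ → Eucl n) (σ : ℝ → Γ) (I : Set ℝ) : Prop where
  classV : ClassVFun V domV domf
  boundedV : ∀ K : Set (Eucl n × Γ), K ⊆ domf ∩ (Oset domV ×ˢ (Set.univ : Set Γ)) →
    IsCompact K → ∃ M : ℝ, ∀ p ∈ K, |V p| ≤ M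
  precompact : PrecompactRel x I (Oset domV)
  nonincr : AntitoneOn (fun t => V (x t, σ t)) (Set.Ici 0)
  wineq : Wineq f V W domV domf
  contW : ContinuousOn W (domf ∩ (Oset domV ×ˢ (Set.univ : Set Γ)))

/-- The set `X^f(g,h,τ)` for finite `τ`. -/
def XFwd {n : ℕ} (X : Set (Eucl n)) (g : Eucl n → Eucl n) (h : Eucl n → ℝ) (τ : ℝ) :
    Set (Eucl n) :=
  {ξ | ∃ φ : ℝ → Eucl n, IsSolOn g X φ (Set.Icc 0 τ) ∧ φ 0 = ξ ∧
    ∀ t ∈ Set.Icc (0 : ℝ) τ, h (φ t) = 0}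

/-- The set `X^b(g,h,τ)` for finite `τ`. -/
def XBwd {n : ℕ} (X : Set (Eucl n)) (g : Eucl n → Eucl n) (h : Eucl n → ℝ) (τ : ℝ) :
    Set (Eucl n) :=
  {ξ | ∃ φ : ℝ → Eucl n, IsSolOn g X φ (Set.Icc (-τ) 0) ∧ φ 0 = ξ ∧
    ∀ t ∈ Set.Icc (-τ) (0 : ℝ), h (φ t) = 0}

/-- The set `X^f(g,h,∞)`. -/
def XFwdInf {n : ℕ} (X : Set (Eucl n)) (g : Eucl n → Eucl n) (h : Eucl n → ℝ) :
    Set (Eucl n) :=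
  {ξ | ∃ φ : ℝ → Eucl n, IsSolOn g X φ (Set.Ici 0) ∧ φ 0 = ξ ∧
    ∀ t ∈ Set.Ici (0 : ℝ), h (φ t) = 0}

/-- The set `X^b(g,h,∞)`. -/
def XBwdInf {n : ℕ} (X : Set (Eucl n)) (g : Eucl n → Eucl n) (h : Eucl n → ℝ) :
    Set (Eucl n) :=
  {ξ | ∃ φ : ℝ → Eucl n, IsSolOn g X φ (Set.Iic 0) ∧ φ 0 = ξ ∧
    ∀ t ∈ Set.Iic (0 : ℝ), h (φ t) = 0}

/-- `X^f(g,h) = ∪_{τ>0} X^f(g,h,τ)`. -/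
def XFwdFin {n : ℕ} (X : Set (Eucl n)) (g : Eucl n → Eucl n) (h : Eucl n → ℝ) :
    Set (Eucl n) :=
  ⋃ τ ∈ Set.Ioi (0 : ℝ), XFwd X g h τ

/-- `X^b(g,h) = ∪_{τ>0} X^b(g,h,τ)`. -/
def XBwdFin {n : ℕ} (X : Set (Eucl n)) (g : Eucl n → Eucl n) (h : Eucl n → ℝ) :
    Set (Eucl n) :=
  ⋃ τ ∈ Set.Ioi (0 : ℝ), XBwd X g h τ

/-- Weakly meagre functions on `[0,∞)`. -/
def WeaklyMeagre (y : ℝ → ℝ) : Prop :=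
  ∀ I : ℕ → Set ℝ, (∀ k, (I k).Nonempty) → (∀ k, I k ⊆ Set.Ici 0) →
    (∀ k, (I k).OrdConnected) → (Pairwise fun k l => Disjoint (I k) (I l)) →
    (∃ δ : ENNReal, 0 < δ ∧ ∀ k, δ ≤ volume (I k)) →
    Filter.Tendsto (fun k => sInf ((fun t => |y t|) '' I k)) Filter.atTop (nhds 0)

/-- Assumption (E0) : the origin is an equilibrium point of the switched system. -/
def AssumpE0 {n : ℕ} {Γ : Type*} (f : Eucl n × Γ → Eucl n) (domf : Set (Eucl n × Γ)) : Prop :=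
  ∀ γ : Γ, ((0 : Eucl n), γ) ∈ domf → f (0, γ) = 0

/-- Assumption (U) : uniqueness of the solution of the IVP `ẋ = f_γ(x)`, `x(0)=0`. -/
def AssumpU {n : ℕ} {Γ : Type*} (f : Eucl n × Γ → Eucl n) (domf : Set (Eucl n × Γ)) : Prop :=
  ∀ γ : Γ, ((0 : Eucl n), γ) ∈ domf →
    ∀ I : Set ℝ, I.OrdConnected → (0 : ℝ) ∈ I →
    ∀ φ ψ : ℝ → Eucl n,
      IsSolOn (fun ξ => f (ξ, γ)) {ξ | (ξ, γ) ∈ domf} φ I →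
      IsSolOn (fun ξ => f (ξ, γ)) {ξ | (ξ, γ) ∈ domf} ψ I →
      φ 0 = 0 → ψ 0 = 0 → ∀ t ∈ I, φ t = ψ t

/-- The set `E_γ` of equilibrium points of `f_γ`. -/
def Egamma {n : ℕ} {Γ : Type*} (f : Eucl n × Γ → Eucl n) (domf : Set (Eucl n × Γ)) (γ : Γ) :
    Set (Eucl n) :=
  {ξ | (ξ, γ) ∈ domf ∧ f (ξ, γ) = 0}

/-- Discrete subsets of `ℝⁿ`. -/
def IsDiscreteSet {n : ℕ} (S : Set (Eucl n)) : Prop :=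
  ∀ ξ ∈ S, ∃ ε > (0 : ℝ), S ∩ Metric.ball ξ ε = {ξ}

/-- Class-K functions (on `[0,∞)`). -/
structure ClassK (α : ℝ → ℝ) : Prop where
  cont : ContinuousOn α (Set.Ici 0)
  mono : StrictMonoOn α (Set.Ici 0)
  zero : α 0 = 0

/-- Class-K∞ functions. -/
structure ClassKInf (α : ℝ → ℝ) extends ClassK α : Prop where
  unbounded : Filter.Tendsto α Filter.atTop Filter.atTop

/-- Local uniform stability of a family of forward complete trajectories. -/
def FamilyLUS {n : ℕ} {Γ : Type*} (T : Set ((ℝ → Eucl n) × (ℝ → Γ))) : Prop :=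
  ∃ r > (0 : ℝ), ∃ α : ℝ → ℝ, ClassK α ∧
    ∀ xs ∈ T, ∀ t₀ : ℝ, 0 ≤ t₀ → ‖xs.1 t₀‖ ≤ r → ∀ t : ℝ, t₀ ≤ t → ‖xs.1 t‖ ≤ α ‖xs.1 t₀‖

/-- Global uniform stability. -/
def FamilyGUS {n : ℕ} {Γ : Type*} (T : Set ((ℝ → Eucl n) × (ℝ → Γ))) : Prop :=
  ∃ α : ℝ → ℝ, ClassKInf α ∧
    ∀ xs ∈ T, ∀ t₀ : ℝ, 0 ≤ t₀ → ∀ t : ℝ, t₀ ≤ t → ‖xs.1 t‖ ≤ α ‖xs.1 t₀‖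

/-- Local asymptotic stability. -/
def FamilyLAS {n : ℕ} {Γ : Type*} (T : Set ((ℝ → Eucl n) × (ℝ → Γ))) : Prop :=
  FamilyLUS T ∧ ∃ η > (0 : ℝ), ∀ xs ∈ T, ‖xs.1 0‖ < η →
    Filter.Tendsto xs.1 Filter.atTop (nhds 0)

/-- Global asymptotic stability. -/
def FamilyGAS {n : ℕ} {Γ : Type*} (T : Set ((ℝ → Eucl n) × (ℝ → Γ))) : Prop :=
  FamilyGUS T ∧ ∀ xs ∈ T, Filter.Tendsto xs.1 Filter.atTop (nhds 0)

/-- A weak Lyapunov pair `(V,W)` for the family `T`. -/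
structure WeakLyapunovPair {n : ℕ} {Γ : Type*} [TopologicalSpace Γ]
    (f : Eucl n × Γ → Eucl n) (domf : Set (Eucl n × Γ)) (V : Eucl n × Γ → ℝ)
    (domV : Set (Eucl n × Γ)) (W : Eucl n × Γ → ℝ)
    (T : Set ((ℝ → Eucl n) × (ℝ → Γ))) : Prop where
  classV : ClassVFun V domV domf
  zeroMem : (0 : Eucl n) ∈ Oset domV
  bounds : ∃ α₁ α₂ : ℝ → ℝ, ClassK α₁ ∧ ClassK α₂ ∧
    ∀ γ : Γ, ∀ ξ ∈ Ogamma domV domf γ, α₁ ‖ξ‖ ≤ V (ξ, γ) ∧ V (ξ, γ) ≤ α₂ ‖ξ‖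
  wineq : Wineq f V W domV domf
  decreasing : ∀ xs ∈ T, ∀ a b : ℝ, 0 ≤ a → a ≤ b →
    (∀ t ∈ Set.Icc a b, xs.1 t ∈ Oset domV) →
    AntitoneOn (fun t => V (xs.1 t, xs.2 t)) (Set.Icc a b)

/-- An F-weak Lyapunov pair `(V,W)` for the family `T`. -/
structure FWeakLyapunovPair {n : ℕ} {Γ : Type*} [TopologicalSpace Γ]
    (f : Eucl n × Γ → Eucl n) (domf : Set (Eucl n × Γ)) (V : Eucl n × Γ → ℝ)
    (domV : Set (Eucl n × Γ)) (W : Eucl n × Γ → ℝ)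
    (T : Set ((ℝ → Eucl n) × (ℝ → Γ))) : Prop where
  classV : ClassVFun V domV domf
  zeroMem : (0 : Eucl n) ∈ Oset domV
  bounds : ∃ α₁ α₂ : ℝ → ℝ, ClassK α₁ ∧ ClassK α₂ ∧
    ∀ γ : Γ, ∀ ξ ∈ Ogamma domV domf γ, α₁ ‖ξ‖ ≤ V (ξ, γ) ∧ V (ξ, γ) ≤ α₂ ‖ξ‖
  wineq : Wineq f V W domV domf
  decreasing : ∀ xs ∈ T, ∀ a b : ℝ, 0 ≤ a → a ≤ b →
    (∀ t ∈ Set.Icc a b, xs.1 t ∈ Oset domV) →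
    ∀ γ : Γ, AntitoneOn (fun t => V (xs.1 t, γ)) (Set.Icc a b ∩ {t | xs.2 t = γ})

/-- `V` is radially unbounded : the class-K bounds may be chosen of class K∞. -/
def RadiallyUnbounded {n : ℕ} {Γ : Type*} (V : Eucl n × Γ → ℝ)
    (domV domf : Set (Eucl n × Γ)) : Prop :=
  ∃ α₁ α₂ : ℝ → ℝ, ClassKInf α₁ ∧ ClassKInf α₂ ∧
    ∀ γ : Γ, ∀ ξ ∈ Ogamma domV domf γ, α₁ ‖ξ‖ ≤ V (ξ, γ) ∧ V (ξ, γ) ≤ α₂ ‖ξ‖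

/-- Simple cycle `{γ_i}_{i=1}^m` of the set-valued map `H`. -/
def IsSimpleCycle {Γ : Type*} (H : Γ → Set Γ) (m : ℕ) (γs : ℕ → Γ) : Prop :=
  3 ≤ m ∧ γs 1 = γs m ∧ (∀ i, 1 ≤ i → i < m → γs (i + 1) ∈ H (γs i)) ∧
  ∀ i j, 1 ≤ i → i < j → j ≤ m → γs i = γs j → i = 1 ∧ j = m

/-- A family of forward complete trajectories of the switched system. -/
def ForwardCompleteFamily {n : ℕ} {Γ : Type*} [TopologicalSpace Γ]
    (f : Eucl n × Γ → Eucl n) (domf : Set (Eucl n × Γ))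
    (T : Set ((ℝ → Eucl n) × (ℝ → Γ))) : Prop :=
  ∀ xs ∈ T, ∃ I : Set ℝ, Set.Ici (0 : ℝ) ⊆ I ∧ IsTrajectory f domf xs.1 xs.2 I

/-- Condition (a) : `O_γ^f(f_γ,W_γ,∞) ∩ O_γ^b(f_γ,W_γ,∞) ⊆ {0}` for every `γ`. -/
def CondA {n : ℕ} {Γ : Type*} (f : Eucl n × Γ → Eucl n)
    (domf domV : Set (Eucl n × Γ)) (W : Eucl n × Γ → ℝ) : Prop :=
  ∀ γ : Γ, XFwdInf (Ogamma domV domf γ) (fun ξ => f (ξ, γ)) (fun ξ => W (ξ, γ)) ∩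
    XBwdInf (Ogamma domV domf γ) (fun ξ => f (ξ, γ)) (fun ξ => W (ξ, γ)) ⊆ {0}

/-- Condition (b) : `O_γ^b(f_γ,W_γ) ∩ O_{γ'}^f(f_{γ'},W_{γ'}) ⊆ {0}` for `γ ≠ γ'`. -/
def CondB {n : ℕ} {Γ : Type*} (f : Eucl n × Γ → Eucl n)
    (domf domV : Set (Eucl n × Γ)) (W : Eucl n × Γ → ℝ) : Prop :=
  ∀ γ γ' : Γ, γ ≠ γ' →
    XBwdFin (Ogamma domV domf γ) (fun ξ => f (ξ, γ)) (fun ξ => W (ξ, γ)) ∩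
    XFwdFin (Ogamma domV domf γ') (fun ξ => f (ξ, γ')) (fun ξ => W (ξ, γ')) ⊆ {0}

/-- Condition (b') : the variant of (b) involving the level sets of `V`. -/
def CondB' {n : ℕ} {Γ : Type*} (f : Eucl n × Γ → Eucl n) (V : Eucl n × Γ → ℝ)
    (domf domV : Set (Eucl n × Γ)) (W : Eucl n × Γ → ℝ) : Prop :=
  ∀ γ γ' : Γ, γ ≠ γ' → ∀ c : ℝ,
    XBwdFin (Ogamma domV domf γ) (fun ξ => f (ξ, γ)) (fun ξ => W (ξ, γ)) ∩
    XFwdFin (Ogamma domV domf γ') (fun ξ => f (ξ, γ')) (fun ξ => W (ξ, γ')) ∩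
    {ξ : Eucl n | V (ξ, γ) = c} ∩ {ξ : Eucl n | V (ξ, γ') = c} ⊆ {0}

/-- Condition (i) of the cycle theorems :
either all the forward infinite-horizon sets, or all the backward ones, reduce to `{0}`. -/
def CondI {n : ℕ} {Γ : Type*} (f : Eucl n × Γ → Eucl n)
    (domf domV : Set (Eucl n × Γ)) (W : Eucl n × Γ → ℝ) : Prop :=
  (∀ γ : Γ, XFwdInf (Ogamma domV domf γ) (fun ξ => f (ξ, γ)) (fun ξ => W (ξ, γ)) ⊆ {0}) ∨
  (∀ γ : Γ, XBwdInf (Ogamma domV domf γ) (fun ξ => f (ξ, γ)) (fun ξ => W (ξ, γ)) ⊆ {0})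

/-- Condition (ii) on simple cycles of `H`. -/
def CondCycle {n : ℕ} {Γ : Type*} (f : Eucl n × Γ → Eucl n)
    (domf domV : Set (Eucl n × Γ)) (W : Eucl n × Γ → ℝ) (H : Γ → Set Γ) : Prop :=
  ∀ m : ℕ, ∀ γs : ℕ → Γ, IsSimpleCycle H m γs →
    ∃ j : ℕ, 1 ≤ j ∧ j < m ∧
      XBwdFin (Ogamma domV domf (γs j)) (fun ξ => f (ξ, γs j)) (fun ξ => W (ξ, γs j)) ∩
      XFwdFin (Ogamma domV domf (γs (j + 1))) (fun ξ => f (ξ, γs (j + 1)))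
        (fun ξ => W (ξ, γs (j + 1))) ⊆ {0}

/-- Condition (iii) on simple cycles of `H`, involving the level sets of `V`. -/
def CondCycle' {n : ℕ} {Γ : Type*} (f : Eucl n × Γ → Eucl n) (V : Eucl n × Γ → ℝ)
    (domf domV : Set (Eucl n × Γ)) (W : Eucl n × Γ → ℝ) (H : Γ → Set Γ) : Prop :=
  ∀ c : ℝ, ∀ m : ℕ, ∀ γs : ℕ → Γ, IsSimpleCycle H m γs →
    ∃ j : ℕ, 1 ≤ j ∧ j < m ∧
      XBwdFin (Ogamma domV domf (γs j)) (fun ξ => f (ξ, γs j)) (fun ξ => W (ξ, γs j)) ∩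
      XFwdFin (Ogamma domV domf (γs (j + 1))) (fun ξ => f (ξ, γs (j + 1)))
        (fun ξ => W (ξ, γs (j + 1))) ∩
      {ξ : Eucl n | V (ξ, γs j) = c} ∩ {ξ : Eucl n | V (ξ, γs (j + 1)) = c} ⊆ {0}

/-- For every `γ`, `O_γ^b(f_γ,W_γ) = E_γ ∩ O_γ` or `O_γ^f(f_γ,W_γ) = E_γ ∩ O_γ`. -/
def CondEquilObs {n : ℕ} {Γ : Type*} (f : Eucl n × Γ → Eucl n)
    (domf domV : Set (Eucl n × Γ)) (W : Eucl n × Γ → ℝ) : Prop :=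
  ∀ γ : Γ,
    XBwdFin (Ogamma domV domf γ) (fun ξ => f (ξ, γ)) (fun ξ => W (ξ, γ)) =
      Egamma f domf γ ∩ Ogamma domV domf γ ∨
    XFwdFin (Ogamma domV domf γ) (fun ξ => f (ξ, γ)) (fun ξ => W (ξ, γ)) =
      Egamma f domf γ ∩ Ogamma domV domf γ

end

noncomputable section
/-- A bounded trajectory is Lipschitz on `[0,∞)`. -/
theorem traj_lipschitz_aux
    {n : ℕ} {Γ : Type*} [MetricSpace Γ] [CompactSpace Γ]
    (f : Eucl n × Γ → Eucl n) (domf : Set (Eucl n × Γ))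
    (hdomf : IsClosed domf) (hf : ContinuousOn f domf)
    (x : ℝ → Eucl n) (σ : ℝ → Γ) (Ix : Set ℝ)
    (htraj : IsTrajectory f domf x σ Ix) (hfc : Set.Ici (0 : ℝ) ⊆ Ix)
    (B : Set (Eucl n)) (hB : IsCompact B) (hxB : ∀ t ∈ Ix, x t ∈ B) :
    ∃ L : ℝ, 0 < L ∧ ∀ s t : ℝ, 0 ≤ s → s ≤ t → dist (x t) (x s) ≤ L * (t - s) := by
  have hK : IsCompact ((B ×ˢ (Set.univ : Set Γ)) ∩ domf) :=
    (hB.prod isCompact_univ).inter_right hdomf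
  obtain ⟨C, hC⟩ := hK.exists_bound_of_continuousOn (hf.mono Set.inter_subset_right)
  refine ⟨max C 1, lt_of_lt_of_le one_pos (le_max_right _ _), ?_⟩
  intro s t hs hst
  have h := (htraj.intg s (hfc hs) t (hfc (hs.trans hst))).2
  have h2 : dist (x t) (x s) = ‖∫ u in s..t, f (x u, σ u)‖ := by
    rw [dist_eq_norm, h, add_sub_cancel_left]
  rw [h2]
  have h3 := intervalIntegral.norm_integral_le_of_norm_le_const (a := s) (b := t) (C := max C 1)
    (f := fun u => f (x u, σ u)) (by
      intro u hu
      rw [Set.uIoc_of_le hst] at hu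
      have hu0 : u ∈ Ix := hfc (hs.trans hu.1.le)
      exact (hC _ ⟨⟨hxB u hu0, Set.mem_univ _⟩, htraj.mem u hu0⟩).trans (le_max_left _ _))
  rwa [abs_of_nonneg (sub_nonneg.2 hst)] at h3

/-- Induction on the number of switches in a window to the right of times where `x` is near `ξ`. -/
theorem gap_aux {n : ℕ} (x : ℝ → Eucl n) (J : Set ℝ)
    (hJ : ∀ a b : ℝ, (J ∩ Set.Ioo a b).Finite) (ξ : Eucl n)
    (L : ℝ) (hL : 0 < L)
    (hLip : ∀ s t : ℝ, 0 ≤ s → s ≤ t → dist (x t) (x s) ≤ L * (t - s)) (m : ℕ) :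
    (∃ c > (0 : ℝ), ∀ ε > (0 : ℝ), ∀ T : ℝ, ∃ s, T ≤ s ∧ dist (x s) ξ < ε ∧
      (J ∩ Set.Ioo s (s + c)).ncard ≤ m) →
    (∃ c > (0 : ℝ), ∀ ε > (0 : ℝ), ∀ T : ℝ, ∃ s, T ≤ s ∧ dist (x s) ξ < ε ∧
      J ∩ Set.Ioo s (s + c) = ∅) := by
  induction m with
  | zero =>
    rintro ⟨c, hc, h⟩
    refine ⟨c, hc, fun ε hε T => ?_⟩
    obtain ⟨s, h1, h2, h3⟩ := h ε hε T
    exact ⟨s, h1, h2, (Set.ncard_eq_zero (hJ _ _)).1 (Nat.le_zero.1 h3)⟩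
  | succ m ih =>
    rintro ⟨c, hc, h⟩
    by_contra hcon
    push Not at hcon
    refine absurd (ih ⟨c / 2, by positivity, fun ε hε T => ?_⟩) (by push Not; exact hcon)
    have hd : 0 < min (c / 2) (ε / (2 * L)) := by positivity
    obtain ⟨ε₀, hε₀, T₀, h0⟩ := hcon _ hd
    obtain ⟨s, hs1, hs2, hs3⟩ := h (min ε₀ (ε / 2)) (by positivity) (max (max T T₀) 0)
    have hsT : T ≤ s := (le_max_left _ _).trans ((le_max_left _ _).trans hs1)
    have hsT0 : T₀ ≤ s := (le_max_right _ _).trans ((le_max_left _ _).trans hs1)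
    have hs0 : 0 ≤ s := (le_max_right _ _).trans hs1
    obtain ⟨t, htJ, hst, htd⟩ := h0 s hsT0 (hs2.trans_le (min_le_left _ _))
    have hd1 := min_le_left (c / 2) (ε / (2 * L))
    have hd2 := min_le_right (c / 2) (ε / (2 * L))
    refine ⟨t, hsT.trans hst.le, ?_, ?_⟩
    · have h4 := hLip s t hs0 hst.le
      have h5 : L * (t - s) ≤ L * (ε / (2 * L)) := by
        apply mul_le_mul_of_nonneg_left _ hL.le
        linarith
      have h6 : L * (ε / (2 * L)) = ε / 2 := by field_simp
      have h7 := hs2.trans_le (min_le_right _ _)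
      have h8 := dist_triangle (x t) (x s) ξ
      linarith
    · have hlt : (J ∩ Set.Ioo t (t + c / 2)).ncard < (J ∩ Set.Ioo s (s + c)).ncard := by
        apply Set.ncard_lt_ncard _ (hJ _ _)
        refine ⟨?_, ?_⟩
        · rintro u ⟨hu, hu1, hu2⟩
          exact ⟨hu, by linarith, by linarith⟩
        · intro hsub
          have := hsub ⟨htJ, hst, by linarith⟩
          exact lt_irrefl _ this.2.1
      omega

theorem omegaSharp_subset_and_proj
    {n : ℕ} {Γ : Type*} [MetricSpace Γ] [CompactSpace Γ]
    (f : Eucl n × Γ → Eucl n) (domf : Set (Eucl n × Γ))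
    (hdomf : IsClosed domf) (hf : ContinuousOn f domf)
    (x : ℝ → Eucl n) (σ : ℝ → Γ) (Ix : Set ℝ)
    (htraj : IsTrajectory f domf x σ Ix) (hfc : Set.Ici (0 : ℝ) ⊆ Ix)
    (hσ : σ ∈ SAall Γ)
    (O : Set (Eucl n)) (hpre : PrecompactRel x Ix O) :
    OmegaSharp x σ ⊆ domf ∩ (O ×ˢ (Set.univ : Set Γ)) ∧
    OmegaLimit x Ix = Prod.fst '' OmegaSharp x σ := by
  obtain ⟨B, hBO, hB, hxB⟩ := hpre
  refine ⟨?_, Set.Subset.antisymm ?_ ?_⟩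
  · rintro ⟨ξ, γ⟩ ⟨s, -, hs0, -, -, hx, hg⟩
    refine ⟨hdomf.mem_of_tendsto (hx.prodMk_nhds hg)
      (Eventually.of_forall fun k => htraj.mem _ (hfc (hs0 k))), ?_, Set.mem_univ _⟩
    exact hBO (hB.isClosed.mem_of_tendsto hx
      (Eventually.of_forall fun k => hxB _ (hfc (hs0 k))))
  · rintro ξ ⟨s, -, -, hsT, hx⟩
    obtain ⟨L, hL, hLip⟩ := traj_lipschitz_aux f domf hdomf hf x σ Ix htraj hfc B hB hxB
    simp only [SAall, Set.mem_iUnion, Set.mem_Ioi] at hσ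
    obtain ⟨τD, hτ, N₀, hsw, hcard⟩ := hσ
    have hJ : ∀ a b : ℝ, (JumpTimes σ ∩ Set.Ioo a b).Finite := fun a b =>
      (hsw.locFinite a b).subset (Set.inter_subset_inter_right _ Set.Ioo_subset_Icc_self)
    obtain ⟨c, hc, H⟩ := gap_aux x (JumpTimes σ) hJ ξ L hL hLip (N₀ + 1) (by
      refine ⟨τD, hτ, fun ε hε T => ?_⟩
      obtain ⟨k, hk1, hk2⟩ := ((hsT.eventually_ge_atTop T).and
        (hx.eventually (Metric.ball_mem_nhds ξ hε))).exists
      refine ⟨s k, hk1, hk2, ?_⟩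
      have h := hcard (s k) (s k + τD) (by linarith)
      rw [add_sub_cancel_left, div_self hτ.ne'] at h
      exact_mod_cast h)
    choose u hu1 hu2 hu3 using fun k : ℕ =>
      H (1 / ((k : ℝ) + 1)) Nat.one_div_pos_of_nat (k : ℝ)
    have huT : Tendsto u atTop atTop := tendsto_atTop_mono hu1 tendsto_natCast_atTop_atTop
    have hux : Tendsto (fun k => x (u k)) atTop (𝓝 ξ) :=
      tendsto_iff_dist_tendsto_zero.2 (squeeze_zero (fun _ => dist_nonneg)
        (fun k => (hu2 k).le) tendsto_one_div_add_atTop_nhds_zero_nat)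
    obtain ⟨φ, hφ, hφu⟩ := strictMono_subseq_of_tendsto_atTop huT
    obtain ⟨⟨r, γ⟩, ψ, hψ, hlim⟩ := CompactSpace.tendsto_subseq
      (fun k => ((tau1 σ (u (φ k)) - ((u (φ k) : ℝ) : EReal), σ (u (φ k))) : EReal × Γ))
    have hm : StrictMono (φ ∘ ψ) := hφ.comp hψ
    refine ⟨(ξ, γ), ⟨u ∘ φ ∘ ψ, hφu.comp hψ, fun k => (Nat.cast_nonneg _).trans (hu1 _),
      huT.comp hm.tendsto_atTop, ⟨r, ?_, ((continuous_fst.tendsto _).comp hlim)⟩,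
      hux.comp hm.tendsto_atTop, ((continuous_snd.tendsto _).comp hlim)⟩, rfl⟩
    refine lt_of_lt_of_le (EReal.coe_pos.2 hc)
      (ge_of_tendsto' ((continuous_fst.tendsto _).comp hlim) fun k => ?_)
    change (c : EReal) ≤ tau1 σ (u (φ (ψ k))) - ((u (φ (ψ k)) : ℝ) : EReal)
    rw [EReal.le_sub_iff_add_le (Or.inl (EReal.coe_ne_bot _)) (Or.inl (EReal.coe_ne_top _))]
    refine le_sInf ?_
    rintro _ ⟨t, ⟨htJ, htu⟩, rfl⟩
    rw [← EReal.coe_add, EReal.coe_le_coe_iff]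
    by_contra hlt
    push Not at hlt
    have : t ∈ JumpTimes σ ∩ Set.Ioo (u (φ (ψ k))) (u (φ (ψ k)) + c) :=
      ⟨htJ, htu, by linarith⟩
    rw [hu3] at this
    exact this
  · rintro _ ⟨⟨ξ, γ⟩, ⟨s, hm, hs0, hsT, -, hx, -⟩, rfl⟩
    exact ⟨s, hm, fun k => hfc (hs0 k), hsT, hx⟩
end
end

section
/- For every τ_D > 0 and every N₀ ∈ ℕ, the family S_a[τ_D,N₀] of switching signals has property P. -/
open Filter Topology MeasureTheory Set

noncomputable section
theorem aux_const_of_cont {Γ : Type*} [MetricSpace Γ] {σ : ℝ → Γ} (h : IsSwitchingSignal σ)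
    {a b : ℝ} (hc : ∀ t ∈ Ioo a b, ContinuousAt σ t) :
    ∀ s ∈ Ioo a b, ∀ s' ∈ Ioo a b, σ s = σ s' := by
  intro s hs s' hs'
  refine (isPreconnected_Ioo (a := a) (b := b)).induction₂ (fun x y => σ x = σ y) ?_ ?_ ?_ hs hs'
  · intro x hx
    apply nhdsWithin_le_nhds
    obtain ⟨ε₁, h1, hr⟩ := h.rightConst x
    obtain ⟨ε₂, h2, hl⟩ := h.leftConst x
    have hx' := hc x hx
    have hmem : ∀ y ∈ Ioo (x - ε₂) x, σ y = σ x := by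
      intro y hy
      have t1 : Tendsto σ (𝓝[<] x) (𝓝 (σ x)) := hx'.tendsto.mono_left nhdsWithin_le_nhds
      have t2 : Tendsto σ (𝓝[<] x) (𝓝 (σ y)) := by
        refine tendsto_const_nhds.congr' ?_
        filter_upwards [Ioo_mem_nhdsLT (show x - ε₂ < x by linarith)] with z hz
        exact hl y hy z hz
      exact tendsto_nhds_unique t2 t1
    filter_upwards [Ioo_mem_nhds (show x - ε₂ < x by linarith) (show x < x + ε₁ by linarith)]
      with y hy
    rcases lt_or_ge y x with hyx | hyx
    · exact (hmem y ⟨hy.1, hyx⟩).symm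
    · exact (hr y ⟨hyx, hy.2⟩).symm
  · intro x y z _ _ _ h1 h2
    exact h1.trans h2
  · intro x y _ _ h1
    exact h1.symm

theorem aux_shift {Γ : Type*} [MetricSpace Γ] {τD : ℝ} {N₀ : ℕ} {σ : ℝ → Γ}
    (h : σ ∈ SA Γ τD N₀) (s : ℝ) : (fun t => σ (t + s)) ∈ SA Γ τD N₀ := by
  obtain ⟨hs, hb⟩ := h
  have hJ : ∀ t, t ∈ JumpTimes (fun t => σ (t + s)) → t + s ∈ JumpTimes σ := by
    intro t ht hc
    apply ht
    exact ContinuousAt.comp (f := fun t : ℝ => t + s) (g := σ) hc (by fun_prop)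
  have hinj : ∀ A : Set ℝ, InjOn (fun t : ℝ => t + s) A := fun A => (add_left_injective s).injOn
  refine ⟨⟨?_, ?_, ?_⟩, ?_⟩
  · intro a b
    refine Set.Finite.of_injOn (f := fun t : ℝ => t + s) ?_ (hinj _) (hs.locFinite (a + s) (b + s))
    rintro t ⟨h1, h2, h3⟩
    exact ⟨hJ t h1, by simpa using h2, by simpa using h3⟩
  · intro t
    obtain ⟨ε, h1, hr⟩ := hs.rightConst (t + s)
    refine ⟨ε, h1, fun u hu => hr _ ⟨by linarith [hu.1], by linarith [hu.2]⟩⟩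
  · intro t
    obtain ⟨ε, h1, hr⟩ := hs.leftConst (t + s)
    refine ⟨ε, h1, fun u hu v hv => hr _ ⟨by linarith [hu.1], by linarith [hu.2]⟩ _
      ⟨by linarith [hv.1], by linarith [hv.2]⟩⟩
  · intro τ₁ τ₂ h12
    have h1 := hb (τ₁ + s) (τ₂ + s) (by linarith)
    have h2 : (JumpTimes (fun t => σ (t + s)) ∩ Ioo τ₁ τ₂).ncard ≤
        (JumpTimes σ ∩ Ioo (τ₁ + s) (τ₂ + s)).ncard := by
      refine Set.ncard_le_ncard_of_injOn (fun t : ℝ => t + s) ?_ (hinj _) ?_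
      · rintro t ⟨h1, h2, h3⟩
        exact ⟨hJ t h1, by simpa using h2, by simpa using h3⟩
      · exact (hs.locFinite (τ₁ + s) (τ₂ + s)).subset
          (inter_subset_inter_right _ Ioo_subset_Icc_self)
    have h3 : τ₂ + s - (τ₁ + s) = τ₂ - τ₁ := by ring
    rw [h3] at h1
    exact le_trans (by exact_mod_cast h2) h1

/-- Good points: eventually no jump in some neighbourhood. -/
def AuxGood {Γ : Type*} [TopologicalSpace Γ] (f : ℕ → ℝ → Γ) : Set ℝ :=
  {t | ∃ a b : ℚ, (a : ℝ) < t ∧ t < b ∧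
    ∀ᶠ k in atTop, JumpTimes (f k) ∩ Ioo (a : ℝ) b = ∅}

theorem aux_subseq {Γ : Type*} [MetricSpace Γ] [CompactSpace Γ] (f : ℕ → ℝ → Γ) :
    ∃ φ : ℕ → ℕ, StrictMono φ ∧
      (∀ q : ℚ, ∃ c, Tendsto (fun k => f (φ k) q) atTop (𝓝 c)) ∧
      (∀ a b : ℚ, (∀ᶠ k in atTop, JumpTimes (f (φ k)) ∩ Ioo (a : ℝ) b = ∅) ∨
        (∀ᶠ k in atTop, (JumpTimes (f (φ k)) ∩ Ioo (a : ℝ) b).Nonempty)) := by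
  classical
  let u : ℕ → (ℚ → Γ) × (ℚ × ℚ → Bool) := fun k =>
    (fun q => f k q, fun p => decide (JumpTimes (f k) ∩ Ioo (p.1 : ℝ) p.2 = ∅))
  obtain ⟨⟨g, B⟩, φ, hφ, hlim⟩ := CompactSpace.tendsto_subseq u
  refine ⟨φ, hφ, ?_, ?_⟩
  · intro q
    refine ⟨g q, ?_⟩
    have h1 := (continuous_fst.tendsto _).comp hlim
    exact (tendsto_pi_nhds.1 h1) q
  · intro a b
    have h1 := (continuous_snd.tendsto _).comp hlim
    have h2 := (tendsto_pi_nhds.1 h1) (a, b)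
    rw [nhds_discrete, tendsto_pure] at h2
    cases hB : B (a, b) with
    | true =>
      left
      filter_upwards [h2] with k hk
      simpa [u, hB] using hk
    | false =>
      right
      filter_upwards [h2] with k hk
      rw [nonempty_iff_ne_empty]
      simpa [u, hB] using hk

theorem aux_count {Γ : Type*} [MetricSpace Γ] {τD : ℝ} {N₀ : ℕ} {f : ℕ → ℝ → Γ}
    (hf : ∀ k, f k ∈ SA Γ τD N₀)
    (hd : ∀ a b : ℚ, (∀ᶠ k in atTop, JumpTimes (f k) ∩ Ioo (a : ℝ) b = ∅) ∨
        (∀ᶠ k in atTop, (JumpTimes (f k) ∩ Ioo (a : ℝ) b).Nonempty))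
    {τ₁ τ₂ : ℝ} (h12 : τ₁ < τ₂) (F : Finset ℝ) (hF : (F : Set ℝ) ⊆ (AuxGood f)ᶜ ∩ Ioo τ₁ τ₂) :
    (F.card : ℝ) ≤ N₀ + (τ₂ - τ₁) / τD := by
  have hsmall : ∀ c : ℝ, 0 < c → ∀ᶠ δ in 𝓝[>] (0 : ℝ), 2 * δ < c := by
    intro c hc
    filter_upwards [Ioo_mem_nhdsGT (show (0 : ℝ) < c / 2 by linarith)] with δ hδ
    linarith [hδ.2]
  have e1 : ∀ᶠ δ in 𝓝[>] (0 : ℝ), ∀ x ∈ F, 2 * δ < x - τ₁ ∧ 2 * δ < τ₂ - x := by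
    rw [Filter.eventually_all_finset]
    intro x hx
    have := (hF hx).2
    exact (hsmall _ (by linarith [this.1])).and (hsmall _ (by linarith [this.2]))
  have e2 : ∀ᶠ δ in 𝓝[>] (0 : ℝ), ∀ x ∈ F, ∀ y ∈ F, x ≠ y → 2 * δ < |x - y| := by
    rw [Filter.eventually_all_finset]
    intro x hx
    rw [Filter.eventually_all_finset]
    intro y hy
    by_cases hxy : x = y
    · exact Eventually.of_forall fun _ h => absurd hxy h
    · filter_upwards [hsmall _ (abs_pos.2 (sub_ne_zero.2 hxy))] with δ hδ _ using hδ
  obtain ⟨δ, ⟨h1, h2⟩, hδ⟩ := ((e1.and e2).and self_mem_nhdsWithin).exists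
  have hδ : 0 < δ := hδ
  have e3 : ∀ᶠ k in atTop, ∀ x ∈ F, (JumpTimes (f k) ∩ Ioo (x - δ) (x + δ)).Nonempty := by
    rw [Filter.eventually_all_finset]
    intro x hx
    obtain ⟨a, ha1, ha2⟩ := exists_rat_btwn (show x - δ < x by linarith)
    obtain ⟨b, hb1, hb2⟩ := exists_rat_btwn (show x < x + δ by linarith)
    rcases hd a b with h | h
    · exact absurd ⟨a, b, ha2, hb1, h⟩ (hF hx).1
    · filter_upwards [h] with k hk
      exact hk.mono (inter_subset_inter_right _ (Ioo_subset_Ioo ha1.le hb2.le))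
  obtain ⟨k, hk⟩ := e3.exists
  choose! j hj using hk
  have hcard : (F : Set ℝ).ncard ≤ (JumpTimes (f k) ∩ Ioo τ₁ τ₂).ncard := by
    refine Set.ncard_le_ncard_of_injOn j ?_ ?_ ?_
    · intro x hx
      have hx1 := hj x hx
      have hx2 := h1 x hx
      exact ⟨hx1.1, by linarith [hx1.2.1], by linarith [hx1.2.2]⟩
    · intro x hx y hy hxy
      by_contra hne
      have h3 := h2 x hx y hy hne
      have hx1 := (hj x hx).2
      have hy1 := (hj y hy).2
      rw [hxy] at hx1
      have : |x - y| < 2 * δ := abs_lt.2 ⟨by linarith [hx1.1, hx1.2, hy1.1, hy1.2],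
        by linarith [hx1.1, hx1.2, hy1.1, hy1.2]⟩
      linarith
    · exact ((hf k).1.locFinite τ₁ τ₂).subset
          (inter_subset_inter_right _ Ioo_subset_Icc_self)
  rw [Set.ncard_coe_finset] at hcard
  exact le_trans (by exact_mod_cast hcard) ((hf k).2 τ₁ τ₂ h12)

theorem aux_finite {B : Set ℝ} {C : ℝ} (h : ∀ F : Finset ℝ, (F : Set ℝ) ⊆ B → (F.card : ℝ) ≤ C) :
    B.Finite ∧ (B.ncard : ℝ) ≤ C := by
  have hfin : B.Finite := by
    by_contra hinf
    obtain ⟨n, hn⟩ := exists_nat_gt C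
    obtain ⟨F, hF, hc⟩ := Set.Infinite.exists_subset_card_eq hinf n
    have := h F hF
    rw [hc] at this
    linarith
  refine ⟨hfin, ?_⟩
  have := h hfin.toFinset (by simp)
  rwa [← Set.ncard_eq_toFinset_card B hfin] at this

/-- Near a good point all signals are eventually constant. -/
theorem aux_good {Γ : Type*} [MetricSpace Γ] {f : ℕ → ℝ → Γ}
    (hf : ∀ k, IsSwitchingSignal (f k)) {t : ℝ} (ht : t ∈ AuxGood f) :
    ∃ a b : ℝ, a < t ∧ t < b ∧
      ∀ᶠ k in atTop, ∀ s ∈ Ioo a b, ∀ s' ∈ Ioo a b, f k s = f k s' := by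
  obtain ⟨a, b, ha, hb, h⟩ := ht
  refine ⟨a, b, ha, hb, ?_⟩
  filter_upwards [h] with k hk
  refine aux_const_of_cont (hf k) fun u hu => ?_
  by_contra hc
  have : u ∈ JumpTimes (f k) ∩ Ioo (a : ℝ) b := ⟨hc, hu⟩
  rw [hk] at this
  exact this

theorem aux_interval {Γ : Type*} [MetricSpace Γ] {f : ℕ → ℝ → Γ}
    (hf : ∀ k, IsSwitchingSignal (f k))
    (hq : ∀ q : ℚ, ∃ c, Tendsto (fun k => f k q) atTop (𝓝 c))
    {a b : ℝ} (hab : a < b) (hG : Ioo a b ⊆ AuxGood f) :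
    ∃ c, ∀ s ∈ Ioo a b, Tendsto (fun k => f k s) atTop (𝓝 c) := by
  obtain ⟨q, hq1, hq2⟩ := exists_rat_btwn hab
  obtain ⟨c, hc⟩ := hq q
  refine ⟨c, fun s hs => ?_⟩
  refine ((isPreconnected_Ioo (a := a) (b := b)).induction₂
    (fun x y => (Tendsto (fun k => f k x) atTop (𝓝 c) ↔ Tendsto (fun k => f k y) atTop (𝓝 c)))
    ?_ ?_ ?_ (show (q : ℝ) ∈ Ioo a b from ⟨hq1, hq2⟩) hs).1 hc
  · intro x hx
    apply nhdsWithin_le_nhds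
    obtain ⟨a', b', h1, h2, h⟩ := aux_good hf (hG hx)
    filter_upwards [Ioo_mem_nhds h1 h2] with y hy
    refine tendsto_congr' ?_
    filter_upwards [h] with k hk
    exact hk x ⟨h1, h2⟩ y hy
  · intro x y z _ _ _ h1 h2
    exact h1.trans h2
  · intro x y _ _ h1
    exact h1.symm

theorem aux_limit {Γ : Type*} [MetricSpace Γ] {τD : ℝ} {N₀ : ℕ} {f : ℕ → ℝ → Γ}
    (hf : ∀ k, f k ∈ SA Γ τD N₀)
    (hq : ∀ q : ℚ, ∃ c, Tendsto (fun k => f k q) atTop (𝓝 c))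
    (hd : ∀ a b : ℚ, (∀ᶠ k in atTop, JumpTimes (f k) ∩ Ioo (a : ℝ) b = ∅) ∨
        (∀ᶠ k in atTop, (JumpTimes (f k) ∩ Ioo (a : ℝ) b).Nonempty)) :
    ∃ g ∈ SA Γ τD N₀, ∀ᵐ t ∂(volume : Measure ℝ),
        Tendsto (fun l => f l t) atTop (𝓝 (g t)) := by
  have hsw := fun k => (hf k).1
  have hB : ∀ τ₁ τ₂ : ℝ, τ₁ < τ₂ → ((AuxGood f)ᶜ ∩ Ioo τ₁ τ₂).Finite ∧
      (((AuxGood f)ᶜ ∩ Ioo τ₁ τ₂).ncard : ℝ) ≤ N₀ + (τ₂ - τ₁) / τD := fun τ₁ τ₂ h12 =>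
    aux_finite fun F hF => aux_count hf hd h12 F hF
  -- punctured neighbourhoods of any point are good
  have hpunct : ∀ t : ℝ, ∃ ε > (0 : ℝ), ∀ s ∈ Ioo (t - ε) (t + ε), s ≠ t → s ∈ AuxGood f := by
    intro t
    have hfin : (((AuxGood f)ᶜ ∩ Ioo (t - 1) (t + 1)) \ {t}).Finite :=
      (hB (t - 1) (t + 1) (by linarith)).1.subset diff_subset
    have hopen := hfin.isClosed.isOpen_compl.mem_nhds
      (show t ∈ (((AuxGood f)ᶜ ∩ Ioo (t - 1) (t + 1)) \ {t})ᶜ from fun h => h.2 rfl)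
    obtain ⟨ε, hε, hsub⟩ := Metric.mem_nhds_iff.1 hopen
    rw [Real.ball_eq_Ioo] at hsub
    refine ⟨min ε 1, lt_min hε one_pos, fun s hs hst => ?_⟩
    by_contra hbad
    have m1 := min_le_left ε 1
    have m2 := min_le_right ε 1
    exact hsub ⟨by linarith [hs.1], by linarith [hs.2]⟩
      ⟨⟨hbad, by linarith [hs.1], by linarith [hs.2]⟩, hst⟩
  have hR : ∀ t : ℝ, ∃ c, ∀ᶠ s in 𝓝[>] t, Tendsto (fun k => f k s) atTop (𝓝 c) := by
    intro t
    obtain ⟨ε, hε, h⟩ := hpunct t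
    obtain ⟨c, hc⟩ := aux_interval hsw hq (show t < t + ε by linarith)
      (fun s hs => h s ⟨by linarith [hs.1], hs.2⟩ hs.1.ne')
    refine ⟨c, ?_⟩
    filter_upwards [Ioo_mem_nhdsGT (show t < t + ε by linarith)] with s hs using hc s hs
  choose g hg using hR
  have hconst : ∀ a b : ℝ, a < b → Ioo a b ⊆ AuxGood f →
      ∃ c, (∀ s ∈ Ioo a b, Tendsto (fun k => f k s) atTop (𝓝 c)) ∧ ∀ s ∈ Ico a b, g s = c := by
    intro a b hab hG
    obtain ⟨c, hc⟩ := aux_interval hsw hq hab hG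
    refine ⟨c, hc, fun s hs => ?_⟩
    obtain ⟨u, hu1, hu2⟩ := ((hg s).and (Ioo_mem_nhdsGT hs.2)).exists
    exact tendsto_nhds_unique hu1 (hc u ⟨by linarith [hs.1, hu2.1], hu2.2⟩)
  have hgood : ∀ t ∈ AuxGood f, ContinuousAt g t ∧ Tendsto (fun k => f k t) atTop (𝓝 (g t)) := by
    intro t ht
    obtain ⟨ε, hε, h⟩ := hpunct t
    obtain ⟨c, hc1, hc2⟩ := hconst (t - ε) (t + ε) (by linarith) (fun s hs => by
      by_cases hst : s = t
      · exact hst ▸ ht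
      · exact h s hs hst)
    have hgt : g t = c := hc2 t ⟨by linarith, by linarith⟩
    constructor
    · have : g =ᶠ[𝓝 t] fun _ => c := by
        filter_upwards [Ioo_mem_nhds (show t - ε < t by linarith) (show t < t + ε by linarith)]
          with s hs using hc2 s ⟨hs.1.le, hs.2⟩
      exact continuousAt_const.congr this.symm
    · rw [hgt]
      exact hc1 t ⟨by linarith, by linarith⟩
  have hJ : JumpTimes g ⊆ (AuxGood f)ᶜ := fun t ht hG => ht (hgood t hG).1
  refine ⟨g, ⟨⟨?_, ?_, ?_⟩, ?_⟩, ?_⟩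
  · intro a b
    rcases le_or_gt a b with hab | hab
    · refine (hB (a - 1) (b + 1) (by linarith)).1.subset ?_
      rintro t ⟨h1, h2, h3⟩
      exact ⟨hJ h1, by linarith, by linarith⟩
    · rw [Icc_eq_empty (not_le.2 hab), inter_empty]
      exact finite_empty
  · intro t
    obtain ⟨ε, hε, h⟩ := hpunct t
    obtain ⟨c, -, hc⟩ := hconst t (t + ε) (by linarith)
      (fun s hs => h s ⟨by linarith [hs.1], hs.2⟩ hs.1.ne')
    exact ⟨ε, hε, fun s hs => (hc s hs).trans (hc t ⟨le_rfl, by linarith⟩).symm⟩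
  · intro t
    obtain ⟨ε, hε, h⟩ := hpunct t
    obtain ⟨c, -, hc⟩ := hconst (t - ε) t (by linarith)
      (fun s hs => h s ⟨hs.1, by linarith [hs.2]⟩ hs.2.ne)
    exact ⟨ε, hε, fun s hs s' hs' => (hc s ⟨hs.1.le, hs.2⟩).trans (hc s' ⟨hs'.1.le, hs'.2⟩).symm⟩
  · intro τ₁ τ₂ h12
    obtain ⟨h1, h2⟩ := hB τ₁ τ₂ h12
    have := Set.ncard_le_ncard (inter_subset_inter_left (Ioo τ₁ τ₂) hJ) h1
    exact le_trans (by exact_mod_cast this) h2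
  · have hcount : ((AuxGood f)ᶜ).Countable := by
      have : (AuxGood f)ᶜ ⊆ ⋃ n : ℕ, ((AuxGood f)ᶜ ∩ Ioo (-(n : ℝ) - 1) (n + 1)) := by
        intro t ht
        obtain ⟨n, hn⟩ := exists_nat_gt |t|
        have := abs_lt.1 hn
        exact mem_iUnion.2 ⟨n, ht, by linarith [this.1], by linarith [this.2]⟩
      refine Set.Countable.mono this (Set.countable_iUnion fun n => ?_)
      have hn : (0 : ℝ) ≤ n := Nat.cast_nonneg n
      exact (hB _ _ (by linarith)).1.countable
    have h0 := hcount.ae_notMem (volume : Measure ℝ)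
    filter_upwards [h0] with t ht
    exact (hgood t (not_not.1 ht)).2

theorem sa_hasPropertyP {Γ : Type*} [MetricSpace Γ] [CompactSpace Γ]
    (τD : ℝ) (hτD : 0 < τD) (N₀ : ℕ) :
    HasPropertyP (SA Γ τD N₀) := by
  refine ⟨⟨τD, hτD, N₀, subset_rfl⟩, fun σ hσ s _ => aux_shift hσ s, ?_⟩
  intro f hf
  obtain ⟨φ, hφ, hq, hd⟩ := aux_subseq f
  obtain ⟨g, hg, hlim⟩ := aux_limit (f := fun k => f (φ k)) (fun k => hf (φ k)) hq hd
  exact ⟨g, hg, φ, hφ, hlim⟩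
end
end

section
/- For every τ_D > 0 and every set-valued map H : Γ ⇉ Γ such that Graph(H) = {(γ,γ′) ∈ Γ × Γ : γ′ ∈ H(γ)} is closed, the family S_d[τ_D] ∩ S^H of switching signals has property P. -/
open Filter Topology MeasureTheory Set

section Helpers

/-- Points of `J` are pairwise at distance at least `τ`. -/
def SepSet (J : Set ℝ) (τ : ℝ) : Prop := ∀ s ∈ J, ∀ t ∈ J, s < t → τ ≤ t - s

theorem SepSet.injOn {J : Set ℝ} {τ : ℝ} (hτ : 0 < τ) (h : SepSet J τ) (a : ℝ) :
    Set.InjOn (fun t : ℝ => ⌊(t - a) / τ⌋) J := by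
  have key : ∀ s ∈ J, ∀ t ∈ J, s < t → ⌊(s - a) / τ⌋ ≠ ⌊(t - a) / τ⌋ := by
    intro s hs t ht hst heq
    have h1 := h s hs t ht hst
    have h2 := Int.abs_sub_lt_one_of_floor_eq_floor heq
    have h3 : (s - a) / τ - (t - a) / τ = -((t - s) / τ) := by ring
    have h4 : 1 ≤ (t - s) / τ := by rwa [le_div_iff₀ hτ, one_mul]
    rw [h3, abs_neg, abs_of_nonneg (by linarith)] at h2
    linarith
  intro s hs t ht heq
  rcases lt_trichotomy s t with h1 | h1 | h1
  · exact absurd heq (key s hs t ht h1)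
  · exact h1
  · exact absurd heq.symm (key t ht s hs h1)

theorem SepSet.mapsTo (J : Set ℝ) {τ : ℝ} (hτ : 0 < τ) (a b : ℝ) :
    Set.MapsTo (fun t : ℝ => ⌊(t - a) / τ⌋) (J ∩ Set.Icc a b) (Set.Icc 0 ⌊(b - a) / τ⌋) := by
  rintro t ⟨-, h1, h2⟩
  refine ⟨Int.floor_nonneg.2 (div_nonneg (by linarith) hτ.le), Int.floor_le_floor ?_⟩
  gcongr

theorem SepSet.finite {J : Set ℝ} {τ : ℝ} (hτ : 0 < τ) (h : SepSet J τ) (a b : ℝ) :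
    (J ∩ Set.Icc a b).Finite :=
  Set.Finite.of_injOn (SepSet.mapsTo J hτ a b) ((h.injOn hτ a).mono Set.inter_subset_left)
    (Set.finite_Icc _ _)

theorem SepSet.countable {J : Set ℝ} {τ : ℝ} (hτ : 0 < τ) (h : SepSet J τ) : J.Countable :=
  Set.MapsTo.countable_of_injOn (Set.mapsTo_univ _ _) (h.injOn hτ 0) (Set.to_countable _)

theorem SepSet.ncard_le {J : Set ℝ} {τ : ℝ} (hτ : 0 < τ) (h : SepSet J τ) (a b : ℝ)
    (hab : a < b) : ((J ∩ Set.Ioo a b).ncard : ℝ) ≤ ((1 : ℕ) : ℝ) + (b - a) / τ := by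
  have h0 : (J ∩ Set.Ioo a b).ncard ≤ (J ∩ Set.Icc a b).ncard :=
    Set.ncard_le_ncard (Set.inter_subset_inter_right _ Set.Ioo_subset_Icc_self) (h.finite hτ a b)
  have h1 : (J ∩ Set.Icc a b).ncard ≤ (Set.Icc 0 ⌊(b - a) / τ⌋).ncard :=
    Set.ncard_le_ncard_of_injOn _ (fun t ht => SepSet.mapsTo J hτ a b ht)
      ((h.injOn hτ a).mono Set.inter_subset_left) (Set.finite_Icc _ _)
  have h2 : (Set.Icc 0 ⌊(b - a) / τ⌋).ncard = (⌊(b - a) / τ⌋ + 1).toNat := by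
    rw [← Finset.coe_Icc, Set.ncard_coe_finset, Int.card_Icc]; simp
  have h3 : 0 ≤ ⌊(b - a) / τ⌋ := Int.floor_nonneg.2 (div_nonneg (by linarith) hτ.le)
  have h4 : ((J ∩ Set.Ioo a b).ncard : ℤ) ≤ ⌊(b - a) / τ⌋ + 1 := by omega
  have h5 : ((J ∩ Set.Ioo a b).ncard : ℝ) ≤ (⌊(b - a) / τ⌋ : ℝ) + 1 := by exact_mod_cast h4
  have h6 := Int.floor_le ((b - a) / τ)
  push_cast
  linarith

variable {Γ : Type*} [MetricSpace Γ]

theorem sd_sep {τ : ℝ} (hτ : 0 < τ) {σ : ℝ → Γ} (h : σ ∈ SD Γ τ) : SepSet (JumpTimes σ) τ := by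
  intro s hs t ht hst
  by_contra! hlt
  obtain ⟨hsw, hb⟩ := h
  set η := (τ - (t - s)) / 4 with hη
  have hη0 : 0 < η := by rw [hη]; linarith
  have h1 := hb (s - η) (t + η) (by linarith)
  have hfin : (JumpTimes σ ∩ Set.Ioo (s - η) (t + η)).Finite :=
    (hsw.locFinite (s - η) (t + η)).subset
      (Set.inter_subset_inter_right _ Set.Ioo_subset_Icc_self)
  have hsub : ({s, t} : Set ℝ) ⊆ JumpTimes σ ∩ Set.Ioo (s - η) (t + η) := by
    rintro x (rfl | rfl)
    · exact ⟨hs, by linarith, by linarith⟩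
    · exact ⟨ht, by linarith, by linarith⟩
  have h2 := Set.ncard_le_ncard hsub hfin
  rw [Set.ncard_pair hst.ne] at h2
  have h3 : (2 : ℝ) ≤ ((JumpTimes σ ∩ Set.Ioo (s - η) (t + η)).ncard : ℝ) := by exact_mod_cast h2
  have h4 : (t + η - (s - η)) / τ < 1 := by
    rw [div_lt_one hτ]; linarith
  push_cast at h1
  linarith

theorem sd_of_sep {τ : ℝ} (hτ : 0 < τ) {σ : ℝ → Γ} (h : SepSet (JumpTimes σ) τ)
    (hr : ∀ t : ℝ, ∃ ε > (0:ℝ), ∀ s ∈ Set.Ico t (t + ε), σ s = σ t)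
    (hl : ∀ t : ℝ, ∃ ε > (0:ℝ), ∀ s ∈ Set.Ioo (t - ε) t, ∀ s' ∈ Set.Ioo (t - ε) t, σ s = σ s') :
    σ ∈ SD Γ τ :=
  ⟨⟨fun a b => h.finite hτ a b, hr, hl⟩, fun a b hab => h.ncard_le hτ a b hab⟩

/-- A switching signal is constant on open intervals without switching times. -/
theorem const_of_no_jump {σ : ℝ → Γ} (h : IsSwitchingSignal σ) {a b : ℝ}
    (hJ : ∀ t ∈ Set.Ioo a b, t ∉ JumpTimes σ) {x y : ℝ} (hx : x ∈ Set.Ioo a b)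
    (hy : y ∈ Set.Ioo a b) : σ x = σ y := by
  refine isPreconnected_Ioo.induction₂ (fun x y => σ x = σ y) ?_ ?_ ?_ hx hy
  · intro t ht
    apply Filter.Eventually.filter_mono nhdsWithin_le_nhds
    have hc : ContinuousAt σ t := not_not.1 (hJ t ht)
    obtain ⟨ε₁, h1, hr⟩ := h.rightConst t
    obtain ⟨ε₂, h2, hl⟩ := h.leftConst t
    have hleft : ∀ s ∈ Set.Ioo (t - ε₂) t, σ s = σ t := by
      intro s hs
      have e1 : Tendsto σ (𝓝[<] t) (𝓝 (σ t)) := hc.tendsto.mono_left nhdsWithin_le_nhds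
      have e2 : Tendsto σ (𝓝[<] t) (𝓝 (σ s)) := by
        refine tendsto_const_nhds.congr' ?_
        filter_upwards [Ioo_mem_nhdsLT (show t - ε₂ < t by linarith)] with u hu
        exact hl s hs u hu
      exact tendsto_nhds_unique e2 e1
    filter_upwards [Ioo_mem_nhds (show t - ε₂ < t by linarith) (show t < t + ε₁ by linarith)]
      with u hu
    rcases lt_or_ge u t with hut | hut
    · exact (hleft u ⟨hu.1, hut⟩).symm
    · exact (hr u ⟨hut, hu.2⟩).symm
  · intro x y z _ _ _ h1 h2
    exact h1.trans h2
  · intro x y _ _ h1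
    exact h1.symm

/-- Right-closed version: constancy on `[s, b)` if there is no jump in `(s, b)`. -/
theorem const_right {σ : ℝ → Γ} (h : IsSwitchingSignal σ) {s b : ℝ}
    (hJ : ∀ t ∈ Set.Ioo s b, t ∉ JumpTimes σ) {y : ℝ} (hy : y ∈ Set.Ioo s b) : σ s = σ y := by
  obtain ⟨ε, h1, hr⟩ := h.rightConst s
  have hsb : s < b := hy.1.trans hy.2
  obtain ⟨u, hu1, hu2⟩ := exists_between (show s < min b (s + ε) from lt_min hsb (by linarith))
  rw [← hr u ⟨hu1.le, hu2.trans_le (min_le_right _ _)⟩]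
  exact const_of_no_jump h hJ ⟨hu1, hu2.trans_le (min_le_left _ _)⟩ hy

theorem jump_shift {σ : ℝ → Γ} {s t : ℝ} (h : t ∈ JumpTimes (fun u => σ (u + s))) :
    t + s ∈ JumpTimes σ := by
  intro hc
  apply h
  exact ContinuousAt.comp (f := fun u : ℝ => u + s) (g := σ) hc (by fun_prop)

theorem shift_mem {τ : ℝ} (hτ : 0 < τ) {H : Γ → Set Γ} {σ : ℝ → Γ} (h : σ ∈ SD Γ τ ∩ SH H)
    (s : ℝ) : (fun t => σ (t + s)) ∈ SD Γ τ ∩ SH H := by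
  obtain ⟨h1, h2⟩ := h
  refine ⟨sd_of_sep hτ ?_ ?_ ?_, ?_⟩
  · intro x hx y hy hxy
    have := sd_sep hτ h1 _ (jump_shift hx) _ (jump_shift hy) (by linarith)
    linarith
  · intro t
    obtain ⟨ε, hε, hr⟩ := h1.1.rightConst (t + s)
    exact ⟨ε, hε, fun u hu => hr (u + s) ⟨by linarith [hu.1], by linarith [hu.2]⟩⟩
  · intro t
    obtain ⟨ε, hε, hr⟩ := h1.1.leftConst (t + s)
    exact ⟨ε, hε, fun u hu v hv => hr (u + s) ⟨by linarith [hu.1], by linarith [hu.2]⟩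
      (v + s) ⟨by linarith [hv.1], by linarith [hv.2]⟩⟩
  · intro t ht γ hγ
    refine h2 (t + s) (jump_shift ht) γ ?_
    have e : Tendsto (fun u : ℝ => u - s) (𝓝[<] (t + s)) (𝓝[<] t) := by
      refine tendsto_nhdsWithin_iff.2 ⟨?_, ?_⟩
      · have : Tendsto (fun u : ℝ => u - s) (𝓝 (t + s)) (𝓝 (t + s - s)) :=
          Continuous.tendsto (by fun_prop) _
        rw [add_sub_cancel_right] at this
        exact this.mono_left nhdsWithin_le_nhds
      · filter_upwards [self_mem_nhdsWithin] with u hu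
        have : u < t + s := hu
        exact Set.mem_Iio.2 (by linarith)
    refine (hγ.comp e).congr ?_
    intro u
    simp

/-- Core of the compactness argument. -/
theorem limit_exists {τ : ℝ} (hτ : 0 < τ) {H : Γ → Set Γ}
    (hH : IsClosed {p : Γ × Γ | p.2 ∈ H p.1})
    (f : ℕ → ℝ → Γ) (hf : ∀ k, f k ∈ SD Γ τ ∩ SH H)
    (hQ : ∀ q : ℚ, ∃ c, Tendsto (fun k => f k q) atTop (𝓝 c))
    (hB : ∀ a b : ℚ, (∀ᶠ k in atTop, ∀ t ∈ Set.Ioo (a : ℝ) b, t ∉ JumpTimes (f k)) ∨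
      (∀ᶠ k in atTop, ∃ t ∈ Set.Ioo (a : ℝ) b, t ∈ JumpTimes (f k))) :
    ∃ g ∈ SD Γ τ ∩ SH H, ∀ᵐ t ∂(volume : Measure ℝ),
      Tendsto (fun k => f k t) atTop (𝓝 (g t)) := by
  set D : Set ℝ := {t | ∀ a b : ℝ, a < t → t < b →
    ∀ᶠ k in atTop, ∃ u ∈ Set.Ioo a b, u ∈ JumpTimes (f k)} with hD
  have hnD : ∀ t, t ∉ D → ∃ δ > 0,
      ∀ᶠ k in atTop, ∀ u ∈ Set.Ioo (t - δ) (t + δ), u ∉ JumpTimes (f k) := by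
    intro t ht
    simp only [hD, Set.mem_setOf_eq, not_forall] at ht
    obtain ⟨a, b, ha, hb, hn⟩ := ht
    obtain ⟨q, hq1, hq2⟩ := exists_rat_btwn ha
    obtain ⟨r, hr1, hr2⟩ := exists_rat_btwn hb
    rcases hB q r with h | h
    · refine ⟨min (t - q) (r - t), lt_min (by linarith) (by linarith), ?_⟩
      filter_upwards [h] with k hk u hu
      have m1 := min_le_left (t - q) (r - t)
      have m2 := min_le_right (t - (q : ℝ)) (r - t)
      exact hk u ⟨by linarith [hu.1], by linarith [hu.2]⟩
    · exfalso
      apply hn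
      filter_upwards [h] with k hk
      obtain ⟨u, hu, hj⟩ := hk
      exact ⟨u, ⟨hq1.trans hu.1, hu.2.trans hr2⟩, hj⟩
  have hsep : SepSet D τ := by
    intro s hs t ht hst
    by_contra! hlt
    set η := min ((τ - (t - s)) / 4) ((t - s) / 2) with hη
    have hη0 : 0 < η := lt_min (by linarith) (by linarith)
    have m1 : η ≤ (τ - (t - s)) / 4 := min_le_left _ _
    have m2 : η ≤ (t - s) / 2 := min_le_right _ _
    obtain ⟨k, ⟨u, hu, hju⟩, ⟨v, hv, hjv⟩⟩ :=
      ((hs (s - η) (s + η) (by linarith) (by linarith)).and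
        (ht (t - η) (t + η) (by linarith) (by linarith))).exists
    have := sd_sep hτ (hf k).1 u hju v hjv (by linarith [hu.2, hv.1])
    linarith [hu.1, hv.2]
  have hpunct : ∀ t, ∃ δ > 0, ∀ u ∈ Set.Ioo (t - δ) (t + δ), u ≠ t → u ∉ D := by
    intro t
    by_cases ht : t ∈ D
    · refine ⟨τ, hτ, fun u hu hne hu' => ?_⟩
      rcases lt_or_gt_of_ne hne with h | h
      · have := hsep u hu' t ht h
        linarith [hu.1]
      · have := hsep t ht u hu' h
        linarith [hu.2]
    · obtain ⟨δ, hδ, h⟩ := hnD t ht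
      refine ⟨δ, hδ, fun u hu _ hu' => ?_⟩
      obtain ⟨k, hk, w, hw, hjw⟩ := (h.and (hu' _ _ hu.1 hu.2)).exists
      exact hk w hw hjw
  -- local limits away from `D`
  have hloc : ∀ t, t ∉ D → ∃ δ > 0, ∃ c, ∀ u ∈ Set.Ioo (t - δ) (t + δ),
      Tendsto (fun k => f k u) atTop (𝓝 c) := by
    intro t ht
    obtain ⟨δ, hδ, h⟩ := hnD t ht
    obtain ⟨q, hq1, hq2⟩ := exists_rat_btwn (show t - δ < t + δ by linarith)
    obtain ⟨c, hc⟩ := hQ q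
    refine ⟨δ, hδ, c, fun u hu => hc.congr' ?_⟩
    filter_upwards [h] with k hk
    exact const_of_no_jump (hf k).1.1 hk ⟨hq1, hq2⟩ hu
  have hint : ∀ a b : ℝ, a < b → (∀ u ∈ Set.Ioo a b, u ∉ D) →
      ∃ c, ∀ u ∈ Set.Ioo a b, Tendsto (fun k => f k u) atTop (𝓝 c) := by
    intro a b hab hn
    obtain ⟨m, hm⟩ := exists_between hab
    obtain ⟨δ, hδ, c, hc⟩ := hloc m (hn m hm)
    refine ⟨c, fun u hu => ?_⟩
    have key : ∀ d, Tendsto (fun k => f k m) atTop (𝓝 d) ↔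
        Tendsto (fun k => f k u) atTop (𝓝 d) := by
      refine isPreconnected_Ioo.induction₂ (fun x y => ∀ d, Tendsto (fun k => f k x) atTop (𝓝 d) ↔
        Tendsto (fun k => f k y) atTop (𝓝 d)) ?_ ?_ ?_ hm hu
      · intro x hx
        apply Filter.Eventually.filter_mono nhdsWithin_le_nhds
        obtain ⟨δ, hδ, c, hc⟩ := hloc x (hn x hx)
        filter_upwards [Ioo_mem_nhds (show x - δ < x by linarith) (show x < x + δ by linarith)]
          with y hy d
        have h1 := hc x ⟨by linarith, by linarith⟩
        have h2 := hc y hy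
        constructor
        · intro h; rwa [tendsto_nhds_unique h h1]
        · intro h; rwa [tendsto_nhds_unique h h2]
      · intro x y z _ _ _ h1 h2 d
        exact (h1 d).trans (h2 d)
      · intro x y _ _ h1 d
        exact (h1 d).symm
    exact (key c).1 (hc m ⟨by linarith, by linarith⟩)
  have hright : ∀ t, ∃ c, ∃ δ > 0, ∀ u ∈ Set.Ioo t (t + δ),
      u ∉ D ∧ Tendsto (fun k => f k u) atTop (𝓝 c) := by
    intro t
    obtain ⟨δ, hδ, h⟩ := hpunct t
    have h' : ∀ u ∈ Set.Ioo t (t + δ), u ∉ D := fun u hu =>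
      h u ⟨by linarith [hu.1], hu.2⟩ hu.1.ne'
    obtain ⟨c, hc⟩ := hint t (t + δ) (by linarith) h'
    exact ⟨c, δ, hδ, fun u hu => ⟨h' u hu, hc u hu⟩⟩
  choose g r hr0 hr using hright
  have hconv : ∀ t, t ∉ D → Tendsto (fun k => f k t) atTop (𝓝 (g t)) := by
    intro t ht
    obtain ⟨δ, hδ, c, hc⟩ := hloc t ht
    obtain ⟨u, hu1, hu2⟩ := exists_between
      (show t < min (t + δ) (t + r t) from lt_min (by linarith) (by linarith [hr0 t]))
    have h1 := hc u ⟨by linarith, hu2.trans_le (min_le_left _ _)⟩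
    have h2 := (hr t u ⟨hu1, hu2.trans_le (min_le_right _ _)⟩).2
    rw [← tendsto_nhds_unique h1 h2]
    exact hc t ⟨by linarith, by linarith⟩
  have hgr : ∀ t, ∀ s ∈ Set.Ico t (t + r t), g s = g t := by
    intro t s hs
    rcases hs.1.eq_or_lt with h | h
    · rw [h]
    · obtain ⟨h1, h2⟩ := hr t s ⟨h, hs.2⟩
      exact tendsto_nhds_unique (hconv s h1) h2
  have hgl : ∀ t, ∃ ε > (0:ℝ), ∃ c, ∀ s ∈ Set.Ioo (t - ε) t, s ∉ D ∧ g s = c := by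
    intro t
    obtain ⟨δ, hδ, h⟩ := hpunct t
    have h' : ∀ u ∈ Set.Ioo (t - δ) t, u ∉ D := fun u hu =>
      h u ⟨hu.1, by linarith [hu.2]⟩ hu.2.ne
    obtain ⟨c, hc⟩ := hint (t - δ) t (by linarith) h'
    exact ⟨δ, hδ, c, fun s hs => ⟨h' s hs, tendsto_nhds_unique (hconv s (h' s hs)) (hc s hs)⟩⟩
  have hJD : JumpTimes g ⊆ D := by
    intro t ht
    by_contra hn
    apply ht
    obtain ⟨δ, hδ, c, hc⟩ := hloc t hn
    obtain ⟨δ', hδ', h⟩ := hpunct t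
    have hE : ∀ᶠ u in 𝓝 t, g u = g t := by
      filter_upwards [Ioo_mem_nhds (show t - δ < t by linarith) (show t < t + δ by linarith),
        Ioo_mem_nhds (show t - δ' < t by linarith) (show t < t + δ' by linarith)] with u hu hu'
      by_cases hut : u = t
      · rw [hut]
      · rw [tendsto_nhds_unique (hconv u (h u hu' hut)) (hc u hu),
          tendsto_nhds_unique (hconv t hn) (hc t ⟨by linarith, by linarith⟩)]
    exact (tendsto_const_nhds (x := g t)).congr' (hE.mono fun u hu => hu.symm)
  refine ⟨g, ⟨sd_of_sep hτ ?_ ?_ ?_, ?_⟩, ?_⟩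
  · intro s hs t ht hst
    exact hsep s (hJD hs) t (hJD ht) hst
  · exact fun t => ⟨r t, hr0 t, hgr t⟩
  · intro t
    obtain ⟨ε, hε, c, hc⟩ := hgl t
    exact ⟨ε, hε, fun s hs s' hs' => (hc s hs).2.trans (hc s' hs').2.symm⟩
  · intro t ht γ hγ
    have htD := hJD ht
    obtain ⟨ε, hε, c, hc⟩ := hgl t
    have hcγ : c = γ := by
      refine tendsto_nhds_unique (tendsto_const_nhds.congr' ?_) hγ
      filter_upwards [Ioo_mem_nhdsLT (show t - ε < t by linarith)] with u hu
      exact (hc u hu).2.symm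
    -- test points around `t`
    set δ := min (min ε (r t)) (τ / 2) with hδ
    have hδ0 : 0 < δ := lt_min (lt_min hε (hr0 t)) (by linarith)
    have m1 : δ ≤ ε := (min_le_left _ _).trans (min_le_left _ _)
    have m2 : δ ≤ r t := (min_le_left _ _).trans (min_le_right _ _)
    have m3 : δ ≤ τ / 2 := min_le_right _ _
    have hp := hc (t - δ / 2) ⟨by linarith, by linarith⟩
    have hq := hr t (t + δ / 2) ⟨by linarith, by linarith⟩
    have hpl := hconv _ hp.1
    rw [hp.2, hcγ] at hpl
    have hmem : ∀ᶠ k in atTop, (f k (t - δ / 2), f k (t + δ / 2)) ∈ {p : Γ × Γ | p.2 ∈ H p.1} := by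
      filter_upwards [htD (t - δ / 2) (t + δ / 2) (by linarith) (by linarith)] with k hk
      obtain ⟨s, hs, hjs⟩ := hk
      have huniq : ∀ u ∈ Set.Ioo (t - δ) (t + δ), u ≠ s → u ∉ JumpTimes (f k) := by
        intro u hu hne hju
        rcases lt_or_gt_of_ne hne with h | h
        · have := sd_sep hτ (hf k).1 u hju s hjs h
          linarith [hu.1, hs.2]
        · have := sd_sep hτ (hf k).1 s hjs u hju h
          linarith [hu.2, hs.1]
      have e1 : f k s = f k (t + δ / 2) :=
        const_right (hf k).1.1 (b := t + δ)
          (fun u hu => huniq u ⟨by linarith [hu.1, hs.1], hu.2⟩ hu.1.ne')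
          ⟨hs.2, by linarith⟩
      have e2 : Tendsto (f k) (𝓝[<] s) (𝓝 (f k (t - δ / 2))) := by
        refine tendsto_const_nhds.congr' ?_
        filter_upwards [Ioo_mem_nhdsLT (show t - δ / 2 < s from hs.1)] with u hu
        exact const_of_no_jump (hf k).1.1 (a := t - δ) (b := s)
          (fun v hv => huniq v ⟨hv.1, by linarith [hv.2, hs.2]⟩ hv.2.ne)
          ⟨by linarith, hs.1⟩ ⟨by linarith [hu.1], hu.2⟩
      have := (hf k).2 s hjs _ e2
      rw [e1] at this
      exact this
    exact hH.mem_of_tendsto (hpl.prodMk_nhds hq.2) hmem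
  · have h0 : volume D = 0 := (hsep.countable hτ).measure_zero volume
    filter_upwards [compl_mem_ae_iff.2 h0] with t ht
    exact hconv t ht

end Helpers

noncomputable section
theorem sd_inter_sh_hasPropertyP {Γ : Type*} [MetricSpace Γ] [CompactSpace Γ]
    (τD : ℝ) (hτD : 0 < τD) (H : Γ → Set Γ)
    (hH : IsClosed {p : Γ × Γ | p.2 ∈ H p.1}) :
    HasPropertyP (SD Γ τD ∩ SH H) := by
  refine ⟨⟨τD, hτD, 1, fun σ hσ => hσ.1⟩, fun σ hσ s _ => shift_mem hτD hσ s, ?_⟩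
  intro F hF
  classical
  let X : ℕ → (ℚ → Γ) × (ℚ × ℚ → Bool) := fun k =>
    (fun q => F k q, fun p => decide (∃ t ∈ Set.Ioo (p.1 : ℝ) p.2, t ∈ JumpTimes (F k)))
  obtain ⟨A, φ, hφ, hA⟩ := CompactSpace.tendsto_subseq X
  have hA1 := (continuous_fst.tendsto A).comp hA
  have hA2 := (continuous_snd.tendsto A).comp hA
  rw [tendsto_pi_nhds] at hA1 hA2
  obtain ⟨g, hg, hconv⟩ := limit_exists hτD hH (fun k => F (φ k)) (fun k => hF _)
    (fun q => ⟨_, hA1 q⟩) (by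
      intro a b
      have h := hA2 (a, b)
      rw [nhds_discrete, tendsto_pure] at h
      cases hb : A.2 (a, b) with
      | false =>
        left
        filter_upwards [h] with k hk t ht hj
        rw [hb] at hk
        exact of_decide_eq_false hk ⟨t, ht, hj⟩
      | true =>
        right
        filter_upwards [h] with k hk
        rw [hb] at hk
        exact of_decide_eq_true hk)
  exact ⟨g, hg, φ, hφ, hconv⟩
end
end

section
/- Suppose Γ is a finite set. Then for every τ_D > 0 and every T > 0, the family S_d[τ_D] ∩ S_e[T] of switching signals has property P. -/
open Filter Topology MeasureTheory Set

noncomputable section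

/-- three-point form of the dwell-time condition -/
def Dwell3 {Γ : Type*} (τD : ℝ) (σ : ℝ → Γ) : Prop :=
  ∀ a b c : ℝ, a < b → b < c → c - a < τD → σ a = σ b ∨ σ b = σ c

def RightC {Γ : Type*} (σ : ℝ → Γ) : Prop :=
  ∀ t : ℝ, ∃ ε > (0:ℝ), ∀ s ∈ Set.Ico t (t + ε), σ s = σ t

lemma sep_finite_card (J : Set ℝ) (τD : ℝ) (hτ : 0 < τD)
    (hJ : ∀ x ∈ J, ∀ y ∈ J, x < y → τD ≤ y - x) (a b : ℝ) (hab : a < b) :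
    (J ∩ Set.Ioo a b).Finite ∧ ((J ∩ Set.Ioo a b).ncard : ℝ) ≤ 1 + (b - a) / τD := by
  set f : ℝ → ℕ := fun x => ⌊(x - a) / τD⌋₊ with hf
  have hinj : Set.InjOn f (J ∩ Set.Ioo a b) := by
    have key : ∀ x ∈ J ∩ Set.Ioo a b, ∀ y ∈ J ∩ Set.Ioo a b, x < y → f x ≠ f y := by
      intro x hx y hy hxy h
      have h1 := hJ x hx.1 y hy.1 hxy
      have h2 : (f y : ℝ) ≤ (y - a) / τD :=
        Nat.floor_le (div_nonneg (by linarith [hy.2.1]) hτ.le)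
      have h3 : (x - a) / τD < (f x : ℝ) + 1 := Nat.lt_floor_add_one _
      have h0 : (0:ℝ) ≤ (x - a) / τD := div_nonneg (by linarith [hx.2.1]) hτ.le
      have h4 : (x - a) / τD + 1 ≤ (y - a) / τD := by
        rw [div_add_one hτ.ne']
        gcongr
        linarith
      have h5 : f x + 1 ≤ f y := by
        have h6 : ((f x : ℕ) : ℝ) ≤ (x - a) / τD := Nat.floor_le h0
        apply Nat.le_floor
        push_cast
        linarith
      omega
    intro x hx y hy h
    rcases lt_trichotomy x y with h' | h' | h'
    · exact absurd h (key x hx y hy h')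
    · exact h'
    · exact absurd h.symm (key y hy x hx h')
  have hmaps : Set.MapsTo f (J ∩ Set.Ioo a b)
      (↑(Finset.range (⌊(b - a) / τD⌋₊ + 1)) : Set ℕ) := by
    intro x hx
    simp only [Finset.coe_range, Set.mem_Iio]
    apply Nat.lt_succ_of_le
    apply Nat.floor_le_floor
    gcongr
    exact hx.2.2.le
  refine ⟨Set.Finite.of_injOn hmaps hinj (Finset.finite_toSet _), ?_⟩
  have h1 := Set.ncard_le_ncard_of_injOn f hmaps hinj (Finset.finite_toSet _)
  rw [Set.ncard_coe_finset, Finset.card_range] at h1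
  have h2 : ((J ∩ Set.Ioo a b).ncard : ℝ) ≤ ((⌊(b - a) / τD⌋₊ + 1 : ℕ) : ℝ) := by
    exact_mod_cast h1
  have h3 : (⌊(b - a) / τD⌋₊ : ℝ) ≤ (b - a) / τD :=
    Nat.floor_le (div_nonneg (by linarith) hτ.le)
  push_cast at h2
  linarith

/-- at a continuity point of a discrete-valued map, the map is locally constant -/
lemma cont_locconst {Γ : Type*} [MetricSpace Γ] [Finite Γ] (σ : ℝ → Γ) (t : ℝ)
    (h : ContinuousAt σ t) : ∃ ε > (0:ℝ), ∀ s, |s - t| < ε → σ s = σ t := by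
  have h1 : ∀ᶠ s in 𝓝 t, σ s = σ t :=
    h.eventually (by
      have : IsOpen ({σ t} : Set Γ) := isOpen_discrete _
      exact this.mem_nhds rfl)
  obtain ⟨ε, hε, h2⟩ := Metric.eventually_nhds_iff.1 h1
  exact ⟨ε, hε, fun s hs => h2 (by rwa [Real.dist_eq])⟩

lemma exists_left_ne {Γ : Type*} [MetricSpace Γ] (σ : ℝ → Γ) (hr : RightC σ) (t u : ℝ)
    (hu : u < t) (h : ¬ ContinuousAt σ t) : ∃ s, u < s ∧ s < t ∧ σ s ≠ σ t := by
  by_contra! hc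
  apply h
  obtain ⟨ε, hε, h1⟩ := hr t
  have h2 : σ =ᶠ[𝓝 t] fun _ => σ t := by
    filter_upwards [Ioo_mem_nhds hu (show t < t + ε by linarith)] with s hs
    rcases lt_or_ge s t with h' | h'
    · exact hc s hs.1 h'
    · exact h1 s ⟨h', hs.2⟩
  exact continuousAt_const.congr h2.symm

lemma jump_sep {Γ : Type*} [MetricSpace Γ] (τD : ℝ) (σ : ℝ → Γ)
    (hr : RightC σ) (hd : Dwell3 τD σ) :
    ∀ x ∈ JumpTimes σ, ∀ y ∈ JumpTimes σ, x < y → τD ≤ y - x := by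
  intro x hx y hy hxy
  by_contra! hlt
  obtain ⟨s, hs1, hs2, hs3⟩ := exists_left_ne σ hr x (y - τD) (by linarith) hx
  obtain ⟨s', hs1', hs2', hs3'⟩ := exists_left_ne σ hr y x hxy hy
  have h1 := (hd s x y hs2 hxy (by linarith)).resolve_left hs3
  have h2 := (hd s x s' hs2 hs1' (by linarith)).resolve_left hs3
  exact hs3' (h2.symm.trans h1)

lemma mem_SD_of {Γ : Type*} [MetricSpace Γ] (τD : ℝ) (hτ : 0 < τD) (σ : ℝ → Γ)
    (hr : RightC σ) (hd : Dwell3 τD σ) : σ ∈ SD Γ τD := by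
  have hsep := jump_sep τD σ hr hd
  refine ⟨⟨?_, hr, ?_⟩, ?_⟩
  · intro a b
    rcases lt_or_ge b a with h | h
    · simp [Set.Icc_eq_empty_of_lt h]
    · refine (sep_finite_card _ τD hτ hsep (a - 1) (b + 1) (by linarith)).1.subset ?_
      rintro x ⟨hx, hx1, hx2⟩
      exact ⟨hx, by linarith, by linarith⟩
  · intro t
    by_cases hc : ∃ a b, t - τD < a ∧ a < b ∧ b < t ∧ σ a ≠ σ b
    · obtain ⟨a, b, h1, h2, h3, h4⟩ := hc
      have key : ∀ s ∈ Set.Ioo (t - (t - b)) t, σ s = σ b := by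
        intro s hs
        exact ((hd a b s h2 (by linarith [hs.1]) (by linarith [hs.2])).resolve_left h4).symm
      exact ⟨t - b, by linarith, fun s hs s' hs' => (key s hs).trans (key s' hs').symm⟩
    · push Not at hc
      refine ⟨τD, hτ, fun s hs s' hs' => ?_⟩
      rcases lt_trichotomy s s' with h | h | h
      · exact hc s s' hs.1 h hs'.2
      · rw [h]
      · exact (hc s' s hs'.1 h hs.2).symm
  · intro a b hab
    simpa using (sep_finite_card _ τD hτ hsep a b hab).2

lemma exists_jump {Γ : Type*} [MetricSpace Γ] [Finite Γ] (σ : ℝ → Γ) (hr : RightC σ)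
    (a b : ℝ) (hab : a < b) (h : σ a ≠ σ b) : ∃ t ∈ JumpTimes σ, a < t ∧ t ≤ b := by
  by_contra! hc
  have hcont : ContinuousOn σ (Set.Icc a b) := by
    intro t ht
    rcases eq_or_lt_of_le ht.1 with h' | h'
    · subst h'
      obtain ⟨ε, hε, h1⟩ := hr a
      have h2 : σ =ᶠ[𝓝[Set.Icc a b] a] fun _ => σ a := by
        filter_upwards [self_mem_nhdsWithin,
          mem_nhdsWithin_of_mem_nhds (Iio_mem_nhds (show a < a + ε by linarith))] with s hs hs'
        exact h1 s ⟨hs.1, hs'⟩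
      exact continuousWithinAt_const.congr_of_eventuallyEq h2 rfl
    · have : ContinuousAt σ t := by
        by_contra hn
        exact absurd ht.2 (not_le.2 (hc t hn h'))
      exact this.continuousWithinAt
  exact h (isPreconnected_Icc.constant hcont ⟨le_rfl, hab.le⟩ ⟨hab.le, le_rfl⟩)

lemma of_mem_SD {Γ : Type*} [MetricSpace Γ] [Finite Γ] (τD : ℝ) (hτ : 0 < τD) (σ : ℝ → Γ)
    (h : σ ∈ SD Γ τD) : RightC σ ∧ Dwell3 τD σ := by
  obtain ⟨hs, hb⟩ := h
  have hr : RightC σ := hs.rightConst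
  refine ⟨hr, ?_⟩
  intro a b c hab hbc hca
  by_contra! hn
  obtain ⟨x, hx, hx1, hx2⟩ := exists_jump σ hr a b hab hn.1
  obtain ⟨y, hy, hy1, hy2⟩ := exists_jump σ hr b c hbc hn.2
  obtain ⟨e, he, he2⟩ : ∃ e > (0:ℝ), c + e - a < τD := ⟨(τD - (c - a)) / 2, by linarith, by linarith⟩
  have h1 := hb a (c + e) (by linarith)
  have hfin : (JumpTimes σ ∩ Set.Ioo a (c + e)).Finite :=
    (hs.locFinite a (c + e)).subset (Set.inter_subset_inter_right _ Set.Ioo_subset_Icc_self)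
  have hsub : ({x, y} : Set ℝ) ⊆ JumpTimes σ ∩ Set.Ioo a (c + e) := by
    rintro z (rfl | rfl)
    · exact ⟨hx, hx1, by linarith⟩
    · exact ⟨hy, by linarith, by linarith⟩
  have h2 := Set.ncard_le_ncard hsub hfin
  rw [Set.ncard_pair (by linarith : x < y).ne] at h2
  have h3 : (2:ℝ) ≤ ((JumpTimes σ ∩ Set.Ioo a (c + e)).ncard : ℝ) := by exact_mod_cast h2
  have h4 : (c + e - a) / τD < 1 := by rw [div_lt_one hτ]; exact he2
  push_cast at h1
  linarith

lemma jump_countable {Γ : Type*} [MetricSpace Γ] (τD : ℝ) (hτ : 0 < τD) (σ : ℝ → Γ)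
    (hr : RightC σ) (hd : Dwell3 τD σ) : (JumpTimes σ).Countable := by
  have h : JumpTimes σ = ⋃ n : ℕ, (JumpTimes σ ∩ Set.Ioo (-(n:ℝ) - 1) ((n:ℝ) + 1)) := by
    ext x
    simp only [Set.mem_iUnion, Set.mem_inter_iff]
    constructor
    · intro hx
      obtain ⟨n, hn⟩ := exists_nat_ge |x|
      have := abs_le.1 hn
      exact ⟨n, hx, by linarith, by linarith⟩
    · rintro ⟨n, hx, _⟩
      exact hx
  rw [h]
  refine Set.countable_iUnion fun n => ?_
  refine (sep_finite_card _ τD hτ (jump_sep τD σ hr hd) _ _ ?_).1.countable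
  have : (0:ℝ) ≤ n := n.cast_nonneg
  linarith

/-- compactness: subsequence converging off the (countable) set of jumps of the limit -/
lemma exists_limit {Γ : Type*} [MetricSpace Γ] [Finite Γ] (τD : ℝ) (hτ : 0 < τD)
    (σ : ℕ → ℝ → Γ) (hd : ∀ k, Dwell3 τD (σ k)) :
    ∃ σs : ℝ → Γ, RightC σs ∧ Dwell3 τD σs ∧ ∃ φ : ℕ → ℕ, StrictMono φ ∧
      ∀ t, t ∉ JumpTimes σs → ∀ᶠ l in atTop, σ (φ l) t = σs t := by
  obtain ⟨g, φ, hφ, hlim⟩ := CompactSpace.tendsto_subseq (fun k => fun q : ℚ => σ k (q : ℝ))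
  have hg : ∀ q : ℚ, ∀ᶠ l in atTop, σ (φ l) (q : ℝ) = g q := by
    intro q
    have h1 := (tendsto_pi_nhds.1 hlim) q
    have h2 : IsOpen ({g q} : Set Γ) := isOpen_discrete _
    exact h1.eventually (h2.mem_nhds rfl)
  have hgd : ∀ a b c : ℚ, a < b → b < c → (c:ℝ) - a < τD → g a = g b ∨ g b = g c := by
    intro a b c hab hbc hca
    obtain ⟨l, ha, hb, hc⟩ := ((hg a).and ((hg b).and (hg c))).exists
    rw [← ha, ← hb, ← hc]
    exact hd _ _ _ _ (by exact_mod_cast hab) (by exact_mod_cast hbc) hca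
  have hright : ∀ t : ℝ, ∃ γ : Γ, ∃ ε > (0:ℝ), ∀ q : ℚ, t < q → (q:ℝ) < t + ε → g q = γ := by
    intro t
    by_cases hc : ∃ a b : ℚ, t < a ∧ a < b ∧ (b:ℝ) < t + τD ∧ g a ≠ g b
    · obtain ⟨a, b, h1, h2, h3, h4⟩ := hc
      refine ⟨g a, a - t, by linarith, fun q hq1 hq2 => ?_⟩
      exact (hgd q a b (by exact_mod_cast (by linarith : (q:ℝ) < a)) h2
        (by linarith)).resolve_right h4
    · push Not at hc
      obtain ⟨p, hp1, hp2⟩ := exists_rat_btwn (show t < t + τD by linarith)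
      refine ⟨g p, τD, hτ, fun q hq1 hq2 => ?_⟩
      rcases lt_trichotomy q p with h | h | h
      · exact hc q p hq1 h hp2
      · rw [h]
      · exact (hc p q hp1 h hq2).symm
  choose σs ε hε hσs using hright
  have happ : ∀ t u : ℝ, t < u → ∃ q : ℚ, t < q ∧ (q:ℝ) < u ∧ g q = σs t := by
    intro t u htu
    obtain ⟨q, hq1, hq2⟩ := exists_rat_btwn (show t < min u (t + ε t) from
      lt_min htu (by linarith [hε t]))
    exact ⟨q, hq1, hq2.trans_le (min_le_left _ _),
      hσs t q hq1 (hq2.trans_le (min_le_right _ _))⟩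
  refine ⟨σs, ?_, ?_, φ, hφ, ?_⟩
  · intro t
    refine ⟨ε t, hε t, fun s hs => ?_⟩
    obtain ⟨q, hq1, hq2, hq3⟩ := happ s (t + ε t) hs.2
    rw [← hq3]
    exact hσs t q (lt_of_le_of_lt hs.1 hq1) hq2
  · intro a b c hab hbc hca
    obtain ⟨p, hp1, hp2, hp3⟩ := happ a b hab
    obtain ⟨q, hq1, hq2, hq3⟩ := happ b c hbc
    obtain ⟨r, hr1, hr2, hr3⟩ := happ c (a + τD) (by linarith)
    rw [← hp3, ← hq3, ← hr3]
    exact hgd p q r (by exact_mod_cast (by linarith : (p:ℝ) < q))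
      (by exact_mod_cast (by linarith : (q:ℝ) < r)) (by linarith)
  · intro t ht
    have hct : ContinuousAt σs t := not_not.1 ht
    obtain ⟨e, he, hloc⟩ := cont_locconst σs t hct
    set m := min e (τD / 2) with hm
    have hm0 : 0 < m := lt_min he (by linarith)
    have hm1 : m ≤ e := min_le_left _ _
    have hm2 : m ≤ τD / 2 := min_le_right _ _
    obtain ⟨p, hp1, hp2, hp3⟩ := happ (t - m / 2) t (by linarith)
    obtain ⟨q, hq1, hq2, hq3⟩ := happ t (t + m) (by linarith)
    have h1 : σs (t - m / 2) = σs t := hloc _ (by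
      rw [abs_lt]; constructor <;> linarith)
    filter_upwards [hg p, hg q] with l hlp hlq
    rcases hd (φ l) p t q hp2 hq1 (by linarith) with h | h
    · rw [← h, hlp, hp3, h1]
    · rw [h, hlq, hq3]

lemma limit_SE {Γ : Type*} [MetricSpace Γ] (τD T : ℝ) (hτ : 0 < τD)
    (σ : ℕ → ℝ → Γ) (hd : ∀ k, Dwell3 τD (σ k)) (he : ∀ k, σ k ∈ SE Γ T)
    (σs : ℝ → Γ) (hr : RightC σs) (C : Set ℝ) (hC : C.Countable)
    (hlim : ∀ t, t ∉ C → ∀ᶠ l in atTop, σ l t = σs t) : σs ∈ SE Γ T := by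
  have hdense : ∀ a b : ℝ, a < b → ∃ p, a < p ∧ p < b ∧ p ∉ C := by
    intro a b hab
    obtain ⟨p, hp, hp'⟩ := (hC.dense_compl ℝ).exists_between hab
    exact ⟨p, hp'.1, hp'.2, hp⟩
  intro t₀ ht₀ γ
  have hδ : ∀ δ > (0:ℝ), ∃ p, t₀ ≤ p ∧ p ≤ t₀ + T + δ ∧ σs p = γ := by
    intro δ hδ
    obtain ⟨η, hη, hη1, hη2⟩ : ∃ η > (0:ℝ), 2 * η ≤ δ ∧ η ≤ τD :=
      ⟨min (δ / 2) τD, lt_min (by linarith) hτ, by linarith [min_le_left (δ / 2) τD],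
        min_le_right _ _⟩
    choose t ht htγ using fun k => he k (t₀ + η) (by linarith) γ
    obtain ⟨ts, hts, ψ, hψ, hconv⟩ := isCompact_Icc.tendsto_subseq ht
    obtain ⟨p, hp1, hp2, hpC⟩ := hdense (ts + η / 4) (ts + η / 2) (by linarith)
    obtain ⟨q, hq1, hq2, hqC⟩ := hdense (ts - η / 2) (ts - η / 4) (by linarith)
    have h1 := hψ.tendsto_atTop.eventually (hlim p hpC)
    have h2 := hψ.tendsto_atTop.eventually (hlim q hqC)
    have h3 := hconv.eventually (Ioo_mem_nhds (show ts - η / 4 < ts by linarith)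
      (show ts < ts + η / 4 by linarith))
    obtain ⟨l, hl1, hl2, hl3⟩ := (h1.and (h2.and h3)).exists
    have hl3a : ts - η / 4 < t (ψ l) := hl3.1
    have hl3b : t (ψ l) < ts + η / 4 := hl3.2
    rcases hd (ψ l) q (t (ψ l)) p (by linarith) (by linarith) (by linarith) with h | h
    · exact ⟨q, by linarith [hts.1], by linarith [hts.2], by rw [← hl2, h, htγ]⟩
    · exact ⟨p, by linarith [hts.1], by linarith [hts.2], by rw [← hl1, ← h, htγ]⟩
  set A : Set ℝ := {t | t₀ ≤ t ∧ σs t = γ} with hA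
  have hbdd : BddBelow A := ⟨t₀, fun x hx => hx.1⟩
  have hne : A.Nonempty := by
    obtain ⟨p, hp1, _, hp3⟩ := hδ 1 one_pos
    exact ⟨p, hp1, hp3⟩
  have hlow : t₀ ≤ sInf A := le_csInf hne fun x hx => hx.1
  refine ⟨sInf A, ⟨hlow, ?_⟩, ?_⟩
  · refine le_of_forall_pos_le_add fun δ hδ0 => ?_
    obtain ⟨p, hp1, hp2, hp3⟩ := hδ δ hδ0
    exact (csInf_le hbdd ⟨hp1, hp3⟩).trans hp2
  · obtain ⟨ε, hε, h⟩ := hr (sInf A)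
    obtain ⟨x, hx, hx2⟩ := exists_lt_of_csInf_lt hne (show sInf A < sInf A + ε by linarith)
    rw [← h x ⟨csInf_le hbdd hx, hx2⟩]
    exact hx.2

theorem sd_inter_se_hasPropertyP {Γ : Type*} [MetricSpace Γ] [Finite Γ]
    (τD T : ℝ) (hτD : 0 < τD) (hT : 0 < T) :
    HasPropertyP (SD Γ τD ∩ SE Γ T) := by
  refine ⟨⟨τD, hτD, 1, fun σ h => h.1⟩, ?_, ?_⟩
  · rintro σ ⟨h1, h2⟩ s hs
    obtain ⟨hr, hd⟩ := of_mem_SD τD hτD σ h1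
    refine ⟨mem_SD_of τD hτD _ ?_ ?_, ?_⟩
    · intro t
      obtain ⟨ε, hε, h⟩ := hr (t + s)
      exact ⟨ε, hε, fun u hu => h (u + s) ⟨by linarith [hu.1], by linarith [hu.2]⟩⟩
    · intro a b c hab hbc hca
      exact hd (a + s) (b + s) (c + s) (by linarith) (by linarith) (by linarith)
    · intro t₀ ht₀ γ
      obtain ⟨t, ht, h⟩ := h2 (t₀ + s) (by linarith) γ
      exact ⟨t - s, ⟨by linarith [ht.1], by linarith [ht.2]⟩, by simpa using h⟩
  · intro σ hσ
    have hd : ∀ k, Dwell3 τD (σ k) := fun k => (of_mem_SD τD hτD _ (hσ k).1).2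
    obtain ⟨σs, hr, hds, φ, hφ, hlim⟩ := exists_limit τD hτD σ hd
    have hC := jump_countable τD hτD σs hr hds
    refine ⟨σs, ⟨mem_SD_of τD hτD σs hr hds, ?_⟩, φ, hφ, ?_⟩
    · exact limit_SE τD T hτD (fun l => σ (φ l)) (fun l => hd _) (fun l => (hσ _).2) σs hr
        _ hC hlim
    · have : ∀ᵐ t ∂(volume : Measure ℝ), t ∉ JumpTimes σs := hC.ae_notMem _
      filter_upwards [this] with t ht
      exact tendsto_nhds_of_eventually_eq (hlim t ht)

end
end
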